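/- arXiv:2510.14918 — 6 statements merged into one kernel-verified Lean document; each statement's English description precedes it below -/
import Mathlib

section
/- There is an absolute constant c₁ > 0 such that for every n and every integer k with 3 ≤ k ≤ (2/ln(2e))·ln log n, every 1-spanner of the uniform line metric on n points with hop-diameter k has treewidth at least c₁·k·(log n)^{2/k} − 1 when k is even, and at least c₁·k·(log n / log log n)^{2/(k-1)} − 1 when k is odd. -/
open SimpleGraph

/-- The weight of a walk: the sum of the weights of its edges. -/
noncomputable def walkWeight {V : Type} {G : SimpleGraph V} (w : Sym2 V → ℝ) {u v : V}
    (p : G.Walk u v) : ℝ := (p.edges.map w).sum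

/-- The unique path between two vertices of a tree (as a walk). -/
noncomputable def treePath {V : Type} {T : SimpleGraph V} (hT : T.IsTree) (u v : V) :
    T.Walk u v :=
  letI := Classical.decEq V
  ((hT.isConnected.preconnected u v).some.toPath : T.Path u v)

/-- The shortest-path metric of an edge-weighted tree. -/
noncomputable def treeDist {V : Type} {T : SimpleGraph V} (hT : T.IsTree) (w : Sym2 V → ℝ)
    (u v : V) : ℝ := walkWeight w (treePath hT u v)

/-- `H` is a 1-spanner with hop-diameter `k` of the distance function `d`:
between every two vertices there is a path in `H` with at most `k` edges whose
total weight equals their distance. -/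
def IsOneSpannerHop {V : Type} (H : SimpleGraph V) (d : V → V → ℝ) (k : ℕ) : Prop :=
  ∀ u v : V, ∃ (m : ℕ) (x : Fin (m+1) → V), m ≤ k ∧ x 0 = u ∧ x (Fin.last m) = v ∧
    (∀ i : Fin m, H.Adj (x i.castSucc) (x i.succ)) ∧
    (∑ i : Fin m, d (x i.castSucc) (x i.succ)) = d u v

/-- `H` is a `t`-spanner with hop-diameter `k` of the distance function `d`. -/
def IsSpannerHop {V : Type} (H : SimpleGraph V) (d : V → V → ℝ) (k : ℕ) (t : ℝ) : Prop :=
  ∀ u v : V, ∃ (m : ℕ) (x : Fin (m+1) → V), m ≤ k ∧ x 0 = u ∧ x (Fin.last m) = v ∧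
    (∀ i : Fin m, H.Adj (x i.castSucc) (x i.succ)) ∧
    (∑ i : Fin m, d (x i.castSucc) (x i.succ)) ≤ t * d u v

/-- A tree decomposition of a graph `G` with index type `ι`. -/
structure TreeDecomp {V : Type} (G : SimpleGraph V) (ι : Type) where
  tree : SimpleGraph ι
  tree_isTree : tree.IsTree
  bag : ι → Finset V
  mem_bag : ∀ v : V, ∃ i, v ∈ bag i
  edge_bag : ∀ u v : V, G.Adj u v → ∃ i, u ∈ bag i ∧ v ∈ bag i
  bag_connected : ∀ v : V, (tree.induce {i : ι | v ∈ bag i}).Connected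

/-- The treewidth of `G` is at most the real number `r`. -/
def TreewidthLE {V : Type} (G : SimpleGraph V) (r : ℝ) : Prop :=
  ∃ (ι : Type) (td : TreeDecomp G ι), ∀ i : ι, ((td.bag i).card : ℝ) - 1 ≤ r

/-- The treewidth of `G` is at least the real number `r`. -/
def TreewidthGE {V : Type} (G : SimpleGraph V) (r : ℝ) : Prop :=
  ∀ (ι : Type) (td : TreeDecomp G ι), ∃ i : ι, r ≤ ((td.bag i).card : ℝ) - 1

/-- The arboricity of `G` is at most `m`: the edges of `G` can be covered by `m` forests. -/
def ArboricityLE {V : Type} (G : SimpleGraph V) (m : ℕ) : Prop :=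
  ∃ F : Fin m → SimpleGraph V, (∀ i, F i ≤ G) ∧ (∀ i, (F i).IsAcyclic) ∧
    ∀ u v : V, G.Adj u v → ∃ i, (F i).Adj u v

/-- The arboricity of `G` is at most the real number `r`. -/
def ArboricityLEReal {V : Type} (G : SimpleGraph V) (r : ℝ) : Prop :=
  ∃ m : ℕ, (m : ℝ) ≤ r ∧ ArboricityLE G m

/-- Ackermann-type function `A`. -/
def ackA : ℕ → ℕ → ℕ
  | 0, n => 2 * n
  | _ + 1, 0 => 1
  | k + 1, n + 1 => ackA k (ackA (k + 1) n)

/-- Ackermann-type function `B`. -/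
def ackB : ℕ → ℕ → ℕ
  | 0, n => n ^ 2
  | _ + 1, 0 => 2
  | k + 1, n + 1 => ackB k (ackB (k + 1) n)

/-- The inverse Ackermann function `α_j(n)`:
`α_{2k}(n) = min {s : A(k,s) ≥ n}` and `α_{2k+1}(n) = min {s : B(k,s) ≥ n}`. -/
noncomputable def invAck (j n : ℕ) : ℕ :=
  if j % 2 = 0 then sInf {s : ℕ | n ≤ ackA (j / 2) s} else sInf {s : ℕ | n ≤ ackB (j / 2) s}

/-- The uniform line metric on `{0, …, n-1}`. -/
def lineDist (n : ℕ) (i j : Fin n) : ℝ := |(i : ℝ) - (j : ℝ)|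

/-- `x` is an ancestor of `y` in the tree `T` rooted at `r`:
`x` lies on the unique path from `r` to `y`. -/
def IsAncestor {V : Type} {T : SimpleGraph V} (hT : T.IsTree) (r x y : V) : Prop :=
  x ∈ (treePath hT r y).support

/-- `G` contains `K_t` as a minor: there are `t` pairwise disjoint connected vertex
subsets with an edge between every two of them. -/
def HasCliqueMinor {V : Type} (G : SimpleGraph V) (t : ℕ) : Prop :=
  ∃ B : Fin t → Set V,
    (∀ i j, i ≠ j → Disjoint (B i) (B j)) ∧
    (∀ i, (G.induce (B i)).Connected) ∧
    (∀ i j, i ≠ j → ∃ u ∈ B i, ∃ v ∈ B j, G.Adj u v)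

namespace LineSpanner

/-- `C` spans a connected subgraph of `G` (the empty set is allowed). -/
def Conn {V : Type} (G : SimpleGraph V) (C : Set V) : Prop :=
  ∀ S : Set V, ∀ x ∈ C, x ∈ S → (∀ u ∈ C, u ∈ S → ∀ v ∈ C, G.Adj u v → v ∈ S) → C ⊆ S

section Conn

variable {V : Type} {G : SimpleGraph V}

lemma Conn.singleton (x : V) : Conn G {x} := by
  rintro S y rfl hy - z rfl
  exact hy

lemma Conn.iUnion_of_mem {ι : Type*} {x : V} {C : ι → Set V} (hC : ∀ i, Conn G (C i))
    (hx : ∀ i, x ∈ C i) : Conn G (⋃ i, C i) := by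
  intro S y hy hyS hcl
  obtain ⟨i, hi⟩ := Set.mem_iUnion.1 hy
  have key : ∀ i, ∀ u ∈ C i, u ∈ S → C i ⊆ S := fun i u hu huS =>
    hC i S u hu huS fun a ha haS b hb hab =>
      hcl a (Set.mem_iUnion.2 ⟨i, ha⟩) haS b (Set.mem_iUnion.2 ⟨i, hb⟩) hab
  have hxS : x ∈ S := key i y hi hyS (hx i)
  exact Set.iUnion_subset fun j => key j x (hx j) hxS

lemma Conn.union_of_mem {x : V} {A B : Set V} (hA : Conn G A) (hB : Conn G B)
    (hxA : x ∈ A) (hxB : x ∈ B) : Conn G (A ∪ B) := by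
  rw [Set.union_eq_iUnion]
  exact Conn.iUnion_of_mem (x := x) (by rintro (_ | _) <;> assumption)
    (by rintro (_ | _) <;> assumption)

lemma Conn.union_of_adj {x y : V} {A B : Set V} (hA : Conn G A) (hB : Conn G B)
    (hx : x ∈ A) (hy : y ∈ B) (hxy : G.Adj x y) : Conn G (A ∪ B) := by
  have hpair : Conn G {x, y} := by
    rintro S z (rfl | rfl) hz hcl w (rfl | rfl)
    · exact hz
    · exact hcl z (by simp) hz w (by simp) hxy
    · exact hcl z (by simp) hz w (by simp) hxy.symm
    · exact hz
  have h1 := Conn.union_of_mem (x := y) (hA.union_of_mem hpair hx (by simp)) hB (by simp) hy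
  convert! h1 using 1
  ext z
  simp only [Set.mem_union, Set.mem_insert_iff, Set.mem_singleton_iff]
  constructor
  · tauto
  · rintro ((h | rfl | rfl) | h) <;> tauto

lemma Conn.of_induce {C : Set V} (h : (G.induce C).Connected) : Conn G C := by
  intro S x hx hxS hcl y hy
  obtain ⟨p⟩ := h.preconnected ⟨x, hx⟩ ⟨y, hy⟩
  have key : ∀ {a b : C} (p : (G.induce C).Walk a b), (a : V) ∈ S → (b : V) ∈ S := by
    intro a b p
    induction p with
    | nil => exact id
    | cons hab _ ih => exact fun ha => ih (hcl _ (Subtype.coe_prop _) ha _ (Subtype.coe_prop _) hab)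
  exact key p hxS

end Conn

section Helly

variable {ι : Type} {T : SimpleGraph ι}

lemma eq_of_adj_of_dist_lt (hT : T.IsTree) {r x y z : ι} (hy : T.Adj y x) (hz : T.Adj z x)
    (hyd : T.dist r x = T.dist r y + 1) (hzd : T.dist r x = T.dist r z + 1) : y = z := by
  obtain ⟨p, hp⟩ := hT.connected.exists_walk_length_eq_dist r y
  obtain ⟨q, hq⟩ := hT.connected.exists_walk_length_eq_dist r z
  have hp' : (p.concat hy).IsPath :=
    Walk.isPath_of_length_eq_dist _ (by rw [Walk.length_concat, hp, hyd])
  have hq' : (q.concat hz).IsPath :=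
    Walk.isPath_of_length_eq_dist _ (by rw [Walk.length_concat, hq, hzd])
  have h : p.concat hy = q.concat hz :=
    congrArg Subtype.val ((hT.isAcyclic.subsingleton_path _ _).elim ⟨_, hp'⟩ ⟨_, hq'⟩)
  have h2 := congrArg Walk.penultimate h
  simpa using h2

/-- Moving from a proper descendant `x` of `b` to a neighbour stays below `b`. -/
lemma dist_add_dist_of_adj (hT : T.IsTree) {r b x y : ι}
    (hx : T.dist r x = T.dist r b + T.dist b x) (hxb : x ≠ b) (hxy : T.Adj x y) :
    T.dist r y = T.dist r b + T.dist b y := by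
  have tri := hT.connected.dist_triangle (u := r) (v := b) (w := y)
  have tri2 := hT.connected.dist_triangle (u := b) (v := x) (w := y)
  have h1 : T.dist x y = 1 := dist_eq_one_iff_adj.2 hxy
  rcases hT.dist_eq_dist_add_one_of_adj r hxy with h | h
  · obtain ⟨p, hp⟩ := hT.connected.exists_walk_length_eq_dist b x
    have hnil : ¬ p.Nil := fun hn => hxb hn.eq.symm
    have hadj := p.adj_penultimate hnil
    have hd : T.dist b p.penultimate + 1 ≤ T.dist b x := by
      have := dist_le p.dropLast
      have h3 : p.dropLast.length + 1 = p.length := by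
        simpa using Walk.length_dropLast_add_one hnil
      omega
    have tri3 := hT.connected.dist_triangle (u := r) (v := b) (w := p.penultimate)
    have hpd : T.dist r x = T.dist r p.penultimate + 1 := by
      rcases hT.dist_eq_dist_add_one_of_adj r hadj with h' | h' <;> omega
    have := eq_of_adj_of_dist_lt hT hadj hxy.symm hpd (by omega)
    subst this
    omega
  · omega

/-- Helly property of connected node sets of a tree. -/
lemma exists_mem_of_pairwise_inter (hT : T.IsTree) {κ : Type*} [Finite κ] (F : κ → Set ι)
    (hF : ∀ c, Conn T (F c)) (hne : ∀ c d, (F c ∩ F d).Nonempty) : ∃ b, ∀ c, b ∈ F c := by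
  classical
  obtain ⟨r⟩ := hT.connected.nonempty
  rcases isEmpty_or_nonempty κ with hκ | hκ
  · exact ⟨r, fun c => (hκ.false c).elim⟩
  have hmin : ∀ c, ∃ b ∈ F c, ∀ y ∈ F c, T.dist r b ≤ T.dist r y := by
    intro c
    obtain ⟨b, hb, h⟩ := (measure (T.dist r)).wf.has_min (F c) (hne c c).left
    exact ⟨b, hb, fun y hy => not_lt.1 (h y hy)⟩
  choose top htop hmin using hmin
  obtain ⟨c, hc⟩ := Finite.exists_max fun c => T.dist r (top c)
  refine ⟨top c, fun d => ?_⟩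
  by_contra hd
  obtain ⟨z, hzc, hzd⟩ := hne c d
  set b := top c
  let S : Set ι := {x | T.dist r x = T.dist r b + T.dist b x}
  have hcS : F c ⊆ S := by
    refine hF c S b (htop c) (by simp [S]) fun u hu huS v hv huv => ?_
    by_cases hub : u = b
    · rw [hub] at huv
      have h1 : T.dist b v = 1 := dist_eq_one_iff_adj.2 huv
      have : T.dist r b ≤ T.dist r v := hmin c v hv
      rcases hT.dist_eq_dist_add_one_of_adj r huv with h | h
      · omega
      · simp only [S, Set.mem_ofPred_eq]
        omega
    · exact dist_add_dist_of_adj hT huS hub huv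
  have hdS : F d ⊆ S := by
    refine hF d S z hzd (hcS hzc) fun u hu huS v hv huv => ?_
    exact dist_add_dist_of_adj hT huS (fun h => hd (h ▸ hu)) huv
  have h1 : T.dist r (top d) = T.dist r b + T.dist b (top d) := hdS (htop d)
  have h2 : T.dist r (top d) ≤ T.dist r b := hc d
  have h3 : T.dist b (top d) = 0 := by omega
  exact hd ((hT.connected.dist_eq_zero_iff.1 h3) ▸ htop d)

end Helly

section Separators

variable {V : Type} {G : SimpleGraph V}

/-- Every finite list of points has a balanced separator with at most `s` vertices. -/
def HasSeparators (G : SimpleGraph V) (s : ℕ) : Prop :=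
  ∀ (m : ℕ) (p : Fin m → V), ∃ B : Finset V, B.card ≤ s ∧
    ∀ C : Set V, Conn G C → (∀ v ∈ C, v ∉ B) → 2 * {t | p t ∈ C}.ncard ≤ m

lemma conn_nodes {ι : Type} (td : TreeDecomp G ι) {C : Set V} (hC : Conn G C) :
    Conn td.tree {i | ∃ v ∈ C, v ∈ td.bag i} := by
  rintro S z ⟨v, hvC, hvz⟩ hzS hcl
  have key : ∀ u ∈ C, ∀ i, u ∈ td.bag i → i ∈ S → ∀ j, u ∈ td.bag j → j ∈ S := by
    intro u hu i hi hiS j hj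
    refine Conn.of_induce (td.bag_connected u) S i hi hiS ?_ hj
    exact fun a ha haS b hb hab => hcl a ⟨u, hu, ha⟩ haS b ⟨u, hu, hb⟩ hab
  have h := hC {u | ∀ i, u ∈ td.bag i → i ∈ S} v hvC (fun i hi => key v hvC z hvz hzS i hi) ?_
  · rintro j ⟨u, hu, huj⟩
    exact h hu j huj
  · intro u hu huS w hw huw j hj
    obtain ⟨i, hui, hwi⟩ := td.edge_bag u w huw
    exact key w hw i hwi (huS i hui) j hj

lemma hasSeparators_of_treeDecomp [Finite V] {ι : Type} (td : TreeDecomp G ι) {s : ℕ}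
    (hs : ∀ i, (td.bag i).card ≤ s) : HasSeparators G s := by
  intro m p
  let κ := {C : Set V // Conn G C ∧ m < 2 * {t | p t ∈ C}.ncard}
  have hinter : ∀ c d : κ, ∃ v, v ∈ c.1 ∧ v ∈ d.1 := by
    intro c d
    by_contra! hcd
    have hdisj : Disjoint {t | p t ∈ c.1} {t | p t ∈ d.1} :=
      Set.disjoint_left.2 fun t ht ht' => hcd _ ht ht'
    have h1 := Set.ncard_union_eq hdisj
    have h2 := Set.ncard_le_card ({t | p t ∈ c.1} ∪ {t | p t ∈ d.1})
    have h3 := c.2.2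
    have h4 := d.2.2
    simp only [Nat.card_eq_fintype_card, Fintype.card_fin] at h2
    omega
  obtain ⟨b, hb⟩ := exists_mem_of_pairwise_inter td.tree_isTree
    (fun c : κ => {i | ∃ v ∈ c.1, v ∈ td.bag i}) (fun c => conn_nodes td c.2.1) fun c d => by
      obtain ⟨v, hvc, hvd⟩ := hinter c d
      obtain ⟨i, hi⟩ := td.mem_bag v
      exact ⟨i, ⟨v, hvc, hi⟩, v, hvd, hi⟩
  refine ⟨td.bag b, hs b, fun C hC hCb => ?_⟩
  by_contra! hlt
  obtain ⟨v, hv, hvb⟩ := hb ⟨C, hC, hlt⟩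
  exact hCb v hv hvb

end Separators

section Regions

variable {V : Type} {G : SimpleGraph V}

/-- There is a walk inside `S` from `u` to `v` with at most `m` edges. -/
inductive Hop (G : SimpleGraph V) (S : Set V) : ℕ → V → V → Prop
  | refl {m : ℕ} {u : V} (hu : u ∈ S) : Hop G S m u u
  | step {m : ℕ} {u v w : V} (hu : u ∈ S) (huv : G.Adj u v) (h : Hop G S m v w) :
      Hop G S (m + 1) u w

namespace Hop

lemma left_mem {S : Set V} {m : ℕ} {u v : V} (h : Hop G S m u v) : u ∈ S := by
  cases h <;> assumption

lemma right_mem {S : Set V} {m : ℕ} {u v : V} (h : Hop G S m u v) : v ∈ S := by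
  induction h <;> assumption

lemma mono {S S' : Set V} (hS : S ⊆ S') {m : ℕ} {u v : V} (h : Hop G S m u v) :
    Hop G S' m u v := by
  induction h with
  | refl hu => exact .refl (hS hu)
  | step hu huv _ ih => exact .step (hS hu) huv ih

lemma mono_length {S : Set V} {m m' : ℕ} {u v : V} (h : Hop G S m u v) (hm : m ≤ m') :
    Hop G S m' u v := by
  induction h generalizing m' with
  | refl hu => exact .refl hu
  | step hu huv _ ih =>
    obtain ⟨m', rfl⟩ := Nat.exists_eq_add_of_le' (Nat.one_le_of_lt hm)
    exact .step hu huv (ih (by omega))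

lemma snoc {S : Set V} {m : ℕ} {u v w : V} (h : Hop G S m u v) (hvw : G.Adj v w) (hw : w ∈ S) :
    Hop G S (m + 1) u w := by
  induction h with
  | refl hu => exact .step hu hvw (.refl hw)
  | step hu huv _ ih => exact .step hu huv (ih hvw)

/-- A walk leaving `X` continues from its first vertex outside `X`. -/
lemma exists_exit {S X : Set V} {m : ℕ} {u v : V} (h : Hop G S m u v) (hu : u ∈ X) (hv : v ∉ X) :
    ∃ m', m = m' + 1 ∧ ∃ x ∈ X, ∃ y, y ∉ X ∧ G.Adj x y ∧ Hop G S m' y v := by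
  induction h with
  | refl _ => exact absurd hu hv
  | @step m a b c ha hab h ih =>
    by_cases hb : b ∈ X
    · obtain ⟨m', rfl, x, hx, y, hy, hxy, hh⟩ := ih hb hv
      exact ⟨m' + 1, rfl, x, hx, y, hy, hxy, hh.mono_length (by omega)⟩
    · exact ⟨m, rfl, a, hu, b, hb, hab, h⟩

end Hop

/-- The vertices covered by a family of finite sets. -/
def dead (D : Finset (Finset V)) : Set V := {v | ∃ A ∈ D, v ∈ A}

lemma dead_mono {D D' : Finset (Finset V)} (h : D ⊆ D') : dead D ⊆ dead D' :=
  fun _ ⟨A, hA, hv⟩ => ⟨A, h hA, hv⟩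

/-- The vertices reachable from `I` without entering the sets of `D`. -/
def region (G : SimpleGraph V) (I : Set V) (D : Finset (Finset V)) : Set V :=
  {v | ∃ u ∈ I, Relation.ReflTransGen (fun a b => G.Adj a b ∧ b ∉ dead D) u v}

/-- `A` has a neighbour in `X`. -/
def Touches (G : SimpleGraph V) (X : Set V) (A : Finset V) : Prop :=
  ∃ x ∈ X, ∃ a ∈ A, G.Adj x a

lemma Touches.mono {X Y : Set V} (h : X ⊆ Y) {A : Finset V} (hA : Touches G X A) :
    Touches G Y A :=
  let ⟨x, hx, a, ha, hxa⟩ := hA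
  ⟨x, h hx, a, ha, hxa⟩

/-- `D` consists of disjoint connected sets that avoid the connected set `I`. -/
structure Config (G : SimpleGraph V) (I : Set V) (D : Finset (Finset V)) : Prop where
  conn : Conn G I
  disj : ∀ v ∈ I, v ∉ dead D
  conn_of_mem : ∀ A ∈ D, Conn G (A : Set V)
  eq_of_mem : ∀ A ∈ D, ∀ B ∈ D, ∀ v ∈ A, v ∈ B → A = B

lemma subset_region {I : Set V} {D : Finset (Finset V)} : I ⊆ region G I D :=
  fun v hv => ⟨v, hv, .refl⟩

lemma region_mono {I I' : Set V} {D D' : Finset (Finset V)} (hI : I' ⊆ I) (hD : D ⊆ D') :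
    region G I' D' ⊆ region G I D := by
  rintro v ⟨u, hu, h⟩
  exact ⟨u, hI hu, Relation.ReflTransGen.mono
    (fun a b hab => ⟨hab.1, fun hb => hab.2 (dead_mono hD hb)⟩) _ _ h⟩

lemma mem_region_of_adj {I : Set V} {D : Finset (Finset V)} {u v : V} (hu : u ∈ region G I D)
    (huv : G.Adj u v) (hv : v ∉ dead D) : v ∈ region G I D :=
  let ⟨w, hw, h⟩ := hu
  ⟨w, hw, h.tail ⟨huv, hv⟩⟩

/-- A connected set that avoids `D` and is adjacent to the region lies in the region. -/
lemma subset_region_of_touches {I : Set V} {D : Finset (Finset V)} {A : Finset V}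
    (hA : Conn G (A : Set V)) (hAD : ∀ v ∈ A, v ∉ dead D) (ht : Touches G (region G I D) A) :
    (A : Set V) ⊆ region G I D := by
  obtain ⟨x, hx, a, ha, hxa⟩ := ht
  exact hA _ a ha (mem_region_of_adj hx hxa (hAD a ha)) fun u _ huX v hv huv =>
    mem_region_of_adj huX huv (hAD v hv)

namespace Config

variable {I : Set V} {D : Finset (Finset V)}

lemma notMem_dead (h : Config G I D) {v : V} (hv : v ∈ region G I D) : v ∉ dead D := by
  obtain ⟨u, hu, hr⟩ := hv
  rcases Relation.ReflTransGen.cases_tail hr with rfl | ⟨w, -, hw⟩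
  · exact h.disj _ hu
  · exact hw.2

lemma conn_region (h : Config G I D) : Conn G (region G I D) := by
  rintro S x ⟨u, hu, hr⟩ hxS hcl
  have huS : u ∈ S := by
    induction hr with
    | refl => exact hxS
    | @tail b c hb hbc ih =>
      exact ih (hcl c ⟨u, hu, hb.tail hbc⟩ hxS b ⟨u, hu, hb⟩ hbc.1.symm)
  have hIS : I ⊆ S := h.conn S u hu huS fun a ha haS b hb hab =>
    hcl a (subset_region ha) haS b (subset_region hb) hab
  rintro y ⟨w, hw, hwy⟩
  induction hwy with
  | refl => exact hIS hw
  | @tail b c hb hbc ih => exact hcl b ⟨w, hw, hb⟩ ih c ⟨w, hw, hb.tail hbc⟩ hbc.1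

end Config

end Regions

section Chain

variable {V : Type} {G : SimpleGraph V}

/-- In a decreasing chain of regions with boundaries of at most `w` sets, the number of stages
whose removed sets can be reached within `ρ` hops from the last region is bounded. -/
lemma chain_length_le {I : ℕ → Set V} {D : ℕ → Finset (Finset V)} {q w : ℕ}
    (hcfg : ∀ τ ≤ q, Config G (I τ) (D τ)) (hI : ∀ τ < q, I (τ + 1) ⊆ I τ)
    (hD : ∀ τ < q, D τ ⊆ D (τ + 1))
    (hw : ∀ τ ≤ q, {A | A ∈ D τ ∧ Touches G (region G (I τ) (D τ)) A}.ncard ≤ w)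
    (ρ : ℕ) : ∀ (ℓ a b : ℕ) (Z : Finset (Finset V)), a ≤ b → b ≤ q →
      Z ⊆ D a → (∀ A ∈ Z, Touches G (region G (I b) (D b)) A) → w ≤ Z.card + ℓ →
      (∀ τ, a ≤ τ → τ < b →
        ∃ u ∈ region G (I b) (D b), ∃ v ∈ dead (D (τ + 1)), Hop G (I τ) ρ u v) →
      b - a + 1 ≤ (ℓ + ρ).choose ρ := by
  classical
  have hDmono : ∀ {σ τ}, σ ≤ τ → τ ≤ q → D σ ⊆ D τ := by
    intro σ τ hστ
    induction hστ with
    | refl => exact fun _ => subset_rfl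
    | step _ ih => exact fun h => (ih (by omega)).trans (hD _ (by omega))
  have hImono : ∀ {σ τ}, σ ≤ τ → τ ≤ q → I τ ⊆ I σ := by
    intro σ τ hστ
    induction hστ with
    | refl => exact fun _ => subset_rfl
    | step _ ih => exact fun h => (hI _ (by omega)).trans (ih (by omega))
  have hXmono : ∀ {σ τ}, σ ≤ τ → τ ≤ q → region G (I τ) (D τ) ⊆ region G (I σ) (D σ) :=
    fun h h' => region_mono (hImono h h') (hDmono h h')
  -- the first vertex of a walk outside of the last region lies in a boundary set
  have hexit : ∀ {b τ ρ : ℕ}, b ≤ q → τ < b →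
      (∃ u ∈ region G (I b) (D b), ∃ v ∈ dead (D (τ + 1)), Hop G (I τ) ρ u v) →
      ∃ m, ρ = m + 1 ∧ ∃ A ∈ D b, Touches G (region G (I b) (D b)) A ∧ A ∉ D τ ∧
        ∃ y ∈ A, ∃ v ∈ dead (D (τ + 1)), Hop G (I τ) m y v := by
    rintro b τ ρ hb hτ ⟨u, hu, v, hv, h⟩
    have hvX : v ∉ region G (I b) (D b) := fun hvX =>
      (hcfg b hb).notMem_dead hvX (dead_mono (hDmono hτ hb) hv)
    obtain ⟨m, rfl, x, hx, y, hy, hxy, hyv⟩ := h.exists_exit hu hvX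
    have hyD : y ∈ dead (D b) := by
      by_contra hyD
      exact hy (mem_region_of_adj hx hxy hyD)
    obtain ⟨A, hA, hyA⟩ := hyD
    exact ⟨m, rfl, A, hA, ⟨x, hx, y, hyA, hxy⟩,
      fun hAτ => (hcfg τ (by omega)).disj y hyv.left_mem ⟨A, hAτ, hyA⟩, y, hyA, v, hv, hyv⟩
  induction ρ with
  | zero =>
    intro ℓ a b Z hab hb hZa hZt hZw hgain
    rcases hab.eq_or_lt with rfl | hlt
    · simp
    · obtain ⟨m, hm, -⟩ := hexit hb hlt (hgain a le_rfl hlt)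
      omega
  | succ ρ ihρ =>
    intro ℓ
    induction ℓ with
    | zero =>
      intro a b Z hab hb hZa hZt hZw hgain
      rcases hab.eq_or_lt with rfl | hlt
      · simp
      obtain ⟨m, hm, A, hA, hAt, hAa, -⟩ := hexit hb hlt (hgain a le_rfl hlt)
      have h1 := hw b hb
      have h2 : ((insert A Z : Finset (Finset V)) : Set (Finset V)).ncard ≤
          {A | A ∈ D b ∧ Touches G (region G (I b) (D b)) A}.ncard := by
        refine Set.ncard_le_ncard ?_ ((D b).finite_toSet.subset fun A hA => hA.1)
        intro B hB
        rcases Finset.mem_insert.1 (Finset.mem_coe.1 hB) with rfl | hB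
        · exact ⟨hA, hAt⟩
        · exact ⟨hDmono hab hb (hZa hB), hZt B hB⟩
      rw [Set.ncard_coe_finset, Finset.card_insert_of_notMem fun h => hAa (hZa h)] at h2
      omega
    | succ ℓ ihℓ =>
      intro a b Z hab hb hZa hZt hZw hgain
      rcases hab.eq_or_lt with rfl | hlt
      · rw [Nat.sub_self, zero_add]
        exact Nat.choose_pos (by omega)
      obtain ⟨m, hm, A, hA, hAt, hAa, -⟩ := hexit hb hlt (hgain a le_rfl hlt)
      have hex : ∃ σ, a < σ ∧ ∃ A ∈ D b, Touches G (region G (I b) (D b)) A ∧ A ∉ D a ∧ A ∈ D σ :=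
        ⟨b, hlt, A, hA, hAt, hAa, hA⟩
      obtain ⟨haσ, B, hBb, hBt, hBa, hBσ⟩ := Nat.find_spec hex
      have hσb : Nat.find hex ≤ b := Nat.find_min' hex ⟨hlt, A, hA, hAt, hAa, hA⟩
      set σ := Nat.find hex
      obtain ⟨σ', hσ'⟩ : ∃ σ', σ = σ' + 1 := ⟨σ - 1, by omega⟩
      have hlate := ihℓ σ b (insert B Z) hσb hb
        (Finset.insert_subset hBσ (hZa.trans (hDmono haσ.le (by omega))))
        (by
          intro C hC
          rcases Finset.mem_insert.1 hC with rfl | hC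
          · exact hBt
          · exact hZt C hC)
        (by rw [Finset.card_insert_of_notMem fun h => hBa (hZa h)]; omega)
        (fun τ h1 h2 => hgain τ (by omega) h2)
      have hearly := ihρ (ℓ + 1) a σ' Z (by omega) (by omega) hZa
        (fun C hC => (hZt C hC).mono (hXmono (by omega) hb)) hZw ?_
      · have hpas : (ℓ + 1 + (ρ + 1)).choose (ρ + 1) =
            (ℓ + 1 + ρ).choose ρ + (ℓ + (ρ + 1)).choose (ρ + 1) := by
          rw [show ℓ + 1 + (ρ + 1) = (ℓ + 1 + ρ) + 1 by ring, Nat.choose_succ_succ,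
            show ℓ + (ρ + 1) = ℓ + 1 + ρ by ring]
        omega
      · intro τ haτ hτσ
        obtain ⟨m', hm', C, hC, hCt, hCτ, y, hy, v, hv, hyv⟩ :=
          hexit hb (by omega) (hgain τ haτ (by omega))
        obtain rfl : ρ = m' := by omega
        refine ⟨y, ?_, v, hv, hyv⟩
        have hCa : C ∉ D a := fun h => hCτ (hDmono haτ (by omega) h)
        refine subset_region_of_touches ((hcfg b hb).conn_of_mem C hC) ?_
          (hCt.mono (hXmono (by omega) hb)) hy
        rintro z hz ⟨E, hE, hzE⟩
        obtain rfl := (hcfg b hb).eq_of_mem C hC E (hDmono (by omega) hb hE) z hz hzE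
        exact Nat.find_min hex (show σ' < σ by omega) ⟨by omega, C, hC, hCt, hCa, hE⟩

end Chain

section Cutting

variable {V : Type} {G : SimpleGraph V}

/-- The number of sets of `D` adjacent to the region of `I`. -/
noncomputable def boundary (G : SimpleGraph V) (I : Set V) (D : Finset (Finset V)) : ℕ :=
  {A | A ∈ D ∧ Touches G (region G I D) A}.ncard

/-- Every connected part of the region avoiding `P` touches at most `m` sets of `D` that
avoid `P`. -/
def Balanced (G : SimpleGraph V) (I : Set V) (D : Finset (Finset V)) (P : Finset V) (m : ℕ) :
    Prop :=
  ∀ C : Set V, Conn G C → C ⊆ region G I D → (∀ v ∈ C, v ∉ P) →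
    {A | A ∈ D ∧ Touches G C A ∧ ∀ v ∈ A, v ∉ P}.ncard ≤ m

lemma finite_sep (D : Finset (Finset V)) (p : Finset V → Prop) : {A | A ∈ D ∧ p A}.Finite :=
  D.finite_toSet.subset fun _ hA => hA.1

lemma Config.ncard_hit_le {I : Set V} {D : Finset (Finset V)} (h : Config G I D) (P : Finset V) :
    {A | A ∈ D ∧ ∃ v ∈ A, v ∈ P}.ncard ≤ P.card := by
  classical
  rcases {A | A ∈ D ∧ ∃ v ∈ A, v ∈ P}.eq_empty_or_nonempty with hemp | ⟨-, -, v₀, -, -⟩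
  · simp [hemp]
  have hch : ∀ A : Finset V, ∃ v, A ∈ {A | A ∈ D ∧ ∃ v ∈ A, v ∈ P} → v ∈ A ∧ v ∈ P := by
    intro A
    by_cases hA : A ∈ {A | A ∈ D ∧ ∃ v ∈ A, v ∈ P}
    · obtain ⟨-, v, hv⟩ := id hA
      exact ⟨v, fun _ => hv⟩
    · exact ⟨v₀, fun h => absurd h hA⟩
  choose f hf using hch
  rw [← Set.ncard_coe_finset]
  refine Set.ncard_le_ncard_of_injOn f (fun A hA => (hf A hA).2) ?_ P.finite_toSet
  intro A hA B hB hAB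
  exact h.eq_of_mem A hA.1 B hB.1 (f A) (hf A hA).1 (hAB ▸ (hf B hB).1)

lemma HasSeparators.exists_balanced {s : ℕ} (hsep : HasSeparators G s) {I : Set V}
    {D : Finset (Finset V)} (h : Config G I D) (hb : boundary G I D ≤ 4 * s) {m : ℕ}
    (p : Fin m → V) :
    ∃ P : Finset V, P.card ≤ 2 * s ∧
      (∀ C : Set V, Conn G C → (∀ v ∈ C, v ∉ P) → 2 * {t | p t ∈ C}.ncard ≤ m) ∧
      Balanced G I D P (2 * s) := by
  classical
  set F := D.filter fun A => Touches G (region G I D) A with hF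
  have hFcard : F.card ≤ 4 * s := by
    rw [← Set.ncard_coe_finset]
    have hFeq : (F : Set (Finset V)) = {A | A ∈ D ∧ Touches G (region G I D) A} := by
      ext A
      simp [hF]
    rw [hFeq]
    exact hb
  have hrep : ∀ A : F, ∃ v, v ∈ A.1 := by
    rintro ⟨A, hA⟩
    obtain ⟨-, x, -, a, ha, -⟩ := Finset.mem_filter.1 hA
    exact ⟨a, ha⟩
  choose rep hrep using hrep
  obtain ⟨B₁, hB₁, hp⟩ := hsep m p
  obtain ⟨B₂, hB₂, hq⟩ := hsep F.card fun t => rep (F.equivFin.symm t)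
  refine ⟨B₁ ∪ B₂, (Finset.card_union_le _ _).trans (by omega),
    fun C hC hCP => hp C hC fun v hv hvB => hCP v hv (Finset.mem_union_left _ hvB), ?_⟩
  intro C hC hCX hCP
  set 𝓐 := {A | A ∈ D ∧ Touches G C A ∧ ∀ v ∈ A, v ∉ B₁ ∪ B₂} with h𝓐
  rcases 𝓐.eq_empty_or_nonempty with hemp | ⟨A₀, hA₀⟩
  · simp [hemp]
  obtain ⟨x, hx, -⟩ := hA₀.2.1
  have hU : Conn G (⋃ A : 𝓐, C ∪ (A.1 : Set V)) := by
    refine Conn.iUnion_of_mem (x := x) ?_ fun A => Or.inl hx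
    rintro ⟨A, hA⟩
    obtain ⟨y, hy, a, ha, hya⟩ := hA.2.1
    exact hC.union_of_adj (h.conn_of_mem A hA.1) hy ha hya
  have h2 := hq _ hU (by
    intro v hv hvB
    obtain ⟨⟨A, hA⟩, hv | hv⟩ := Set.mem_iUnion.1 hv
    · exact hCP v hv (Finset.mem_union_right _ hvB)
    · exact hA.2.2 v hv (Finset.mem_union_right _ hvB))
  have hmemF : ∀ A ∈ 𝓐, A ∈ F := fun A hA =>
    Finset.mem_filter.2 ⟨hA.1, hA.2.1.mono hCX⟩
  have h3 : 𝓐.ncard ≤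
      {t | rep (F.equivFin.symm t) ∈ ⋃ A : 𝓐, C ∪ (A.1 : Set V)}.ncard := by
    refine Set.ncard_le_ncard_of_injOn
      (fun A => if hA : A ∈ F then F.equivFin ⟨A, hA⟩ else F.equivFin ⟨A₀, hmemF A₀ hA₀⟩) ?_ ?_
    · intro A hA
      simp only [hmemF A hA, dif_pos]
      refine Set.mem_iUnion.2 ⟨⟨A, hA⟩, Or.inr ?_⟩
      simpa using hrep ⟨A, hmemF A hA⟩
    · intro A hA B hB hAB
      simpa [hmemF A hA, hmemF B hB] using hAB
  omega

/-- Removing the vertices of a balanced set from the region. -/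
lemma Config.exists_cut {I K : Set V} {D : Finset (Finset V)} {P : Finset V} {s : ℕ}
    (h : Config G I D) (hbal : Balanced G I D P (2 * s)) (hP : P.card ≤ 2 * s)
    (hKI : K ⊆ I) (hK : Conn G K) (hKP : ∀ v ∈ K, v ∉ P) :
    ∃ D', D ⊆ D' ∧ Config G K D' ∧ boundary G K D' ≤ 4 * s ∧ ∀ v ∈ I, v ∈ P → v ∈ dead D' := by
  classical
  set D' := D ∪ (P.filter fun v => v ∈ region G I D).image fun v => {v} with hD'
  have hsub : D ⊆ D' := Finset.subset_union_left
  have hmem : ∀ A ∈ D', A ∈ D ∨ ∃ v ∈ P, v ∈ region G I D ∧ A = {v} := by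
    intro A hA
    rcases Finset.mem_union.1 hA with hA | hA
    · exact Or.inl hA
    · obtain ⟨v, hv, rfl⟩ := Finset.mem_image.1 hA
      exact Or.inr ⟨v, (Finset.mem_filter.1 hv).1, (Finset.mem_filter.1 hv).2, rfl⟩
  have hdead : ∀ v ∈ P, v ∈ region G I D → v ∈ dead D' := fun v hv hvX =>
    ⟨{v}, Finset.mem_union_right _ (Finset.mem_image.2 ⟨v, Finset.mem_filter.2 ⟨hv, hvX⟩, rfl⟩),
      Finset.mem_singleton_self v⟩
  have hcfg : Config G K D' := by
    refine ⟨hK, ?_, ?_, ?_⟩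
    · rintro v hv ⟨A, hA, hvA⟩
      rcases hmem A hA with hA | ⟨u, hu, -, rfl⟩
      · exact h.disj v (hKI hv) ⟨A, hA, hvA⟩
      · rw [Finset.mem_singleton.1 hvA] at hv
        exact hKP u hv hu
    · intro A hA
      rcases hmem A hA with hA | ⟨u, -, -, rfl⟩
      · exact h.conn_of_mem A hA
      · simpa using Conn.singleton u
    · intro A hA B hB v hvA hvB
      rcases hmem A hA with hA | ⟨u, -, huX, rfl⟩ <;> rcases hmem B hB with hB | ⟨u', -, hu'X, rfl⟩
      · exact h.eq_of_mem A hA B hB v hvA hvB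
      · rw [Finset.mem_singleton.1 hvB] at hvA
        exact absurd ⟨A, hA, hvA⟩ (h.notMem_dead hu'X)
      · rw [Finset.mem_singleton.1 hvA] at hvB
        exact absurd ⟨B, hB, hvB⟩ (h.notMem_dead huX)
      · rw [← Finset.mem_singleton.1 hvA, ← Finset.mem_singleton.1 hvB]
  have hXX : region G K D' ⊆ region G I D := region_mono hKI hsub
  refine ⟨D', hsub, hcfg, ?_, fun v hv hvP => hdead v hvP (subset_region hv)⟩
  have h1 := hbal (region G K D') hcfg.conn_region hXX
    fun v hv hvP => hcfg.notMem_dead hv (hdead v hvP (hXX hv))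
  have h2 := hcfg.ncard_hit_le P
  refine (Set.ncard_le_ncard (t := {A | A ∈ D ∧ Touches G (region G K D') A ∧ ∀ v ∈ A, v ∉ P} ∪
    {A | A ∈ D' ∧ ∃ v ∈ A, v ∈ P}) ?_ ((finite_sep _ _).union (finite_sep _ _))).trans
    ((Set.ncard_union_le _ _).trans (by omega))
  rintro A ⟨hA, hAt⟩
  by_cases hAP : ∃ v ∈ A, v ∈ P
  · exact Or.inr ⟨hA, hAP⟩
  · push Not at hAP
    rcases hmem A hA with hA | ⟨u, hu, -, rfl⟩
    · exact Or.inl ⟨hA, hAt, hAP⟩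
    · exact absurd hu (hAP u (Finset.mem_singleton_self u))

end Cutting

section Iteration

lemma exists_sequence {σ : Type*} {Inv : ℕ → σ → Prop} {Gain : σ → σ → Prop}
    (step : ∀ e s, Inv (e + 1) s → ∃ s', Inv e s' ∧ Gain s s') (Q : ℕ) :
    ∀ s, Inv Q s → ∃ f : ℕ → σ, f 0 = s ∧ (∀ τ ≤ Q, Inv (Q - τ) (f τ)) ∧
      ∀ τ < Q, Gain (f τ) (f (τ + 1)) := by
  induction Q with
  | zero =>
    intro s hs
    exact ⟨fun _ => s, rfl, fun τ _ => by simpa using hs, fun τ h => absurd h (by omega)⟩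
  | succ Q ih =>
    intro s hs
    obtain ⟨s', hs', hg⟩ := step Q s hs
    obtain ⟨f, hf0, hf, hfg⟩ := ih s' hs'
    refine ⟨fun τ => Nat.casesOn τ s f, rfl, ?_, ?_⟩
    · rintro (_ | τ) hτ
      · exact hs
      · simpa using hf τ (by omega)
    · rintro (_ | τ) hτ
      · simpa [hf0] using hg
      · exact hfg τ (by omega)

variable {V : Type} {G : SimpleGraph V}

/-- All vertices of `I'` reach, within `r` hops inside `I`, a vertex that is removed. -/
structure Gain (G : SimpleGraph V) (r : ℕ) (I : Set V) (D : Finset (Finset V)) (I' : Set V)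
    (D' : Finset (Finset V)) : Prop where
  subset : I' ⊆ I
  dead_subset : D ⊆ D'
  reach : ∀ u ∈ I', ∃ v ∈ dead D', Hop G I r u v

lemma succ_le_choose_of_steps {r w Q : ℕ}
    {Inv : ℕ → Set V × Finset (Finset V) × Finset V → Prop}
    (hcfg : ∀ e x, Inv e x → Config G x.1 x.2.1 ∧ x.1.Nonempty ∧ boundary G x.1 x.2.1 ≤ w)
    (step : ∀ e x, Inv (e + 1) x → ∃ y, Inv e y ∧ Gain G r x.1 x.2.1 y.1 y.2.1)
    {x : Set V × Finset (Finset V) × Finset V} (hx : Inv Q x) : Q + 1 ≤ (w + r).choose r := by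
  obtain ⟨f, -, hf, hg⟩ := exists_sequence (Gain := fun x y => Gain G r x.1 x.2.1 y.1 y.2.1)
    step Q x hx
  obtain ⟨u, hu⟩ := (hcfg _ _ (hf Q le_rfl)).2.1
  have hmono : ∀ {σ τ}, σ ≤ τ → τ ≤ Q → (f τ).1 ⊆ (f σ).1 := by
    intro σ τ hστ
    induction hστ with
    | refl => exact fun _ => subset_rfl
    | step _ ih => exact fun h => (hg _ (by omega)).subset.trans (ih (by omega))
  refine chain_length_le (G := G) (I := fun τ => (f τ).1) (D := fun τ => (f τ).2.1) (q := Q)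
    (fun τ hτ => (hcfg _ _ (hf τ hτ)).1) (fun τ hτ => (hg τ hτ).subset)
    (fun τ hτ => (hg τ hτ).dead_subset) (fun τ hτ => (hcfg _ _ (hf τ hτ)).2.2) r w 0 Q ∅
    (Nat.zero_le _) le_rfl (Finset.empty_subset _) (by simp) (by simp) ?_
  intro τ _ hτ
  exact ⟨u, subset_region hu, (hg τ hτ).reach u (hmono (by omega) le_rfl hu)⟩

end Iteration

section Line

variable {n : ℕ} {H : SimpleGraph (Fin n)}

/-- There is an increasing path from `u` to `v` with at most `m` edges. -/
inductive MonoPath (H : SimpleGraph (Fin n)) : ℕ → Fin n → Fin n → Prop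
  | refl {m : ℕ} {u : Fin n} : MonoPath H m u u
  | step {m : ℕ} {u x v : Fin n} (hux : u < x) (hadj : H.Adj u x) (h : MonoPath H m x v) :
      MonoPath H (m + 1) u v

namespace MonoPath

lemma le {m : ℕ} {u v : Fin n} (h : MonoPath H m u v) : u ≤ v := by
  induction h with
  | refl => exact le_rfl
  | step hux _ _ ih => exact hux.le.trans ih

lemma cases_succ {M m : ℕ} {u v : Fin n} (h : MonoPath H M u v) (hM : M = m + 1) :
    u = v ∨ ∃ x, u < x ∧ H.Adj u x ∧ MonoPath H m x v := by
  cases h with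
  | refl => exact Or.inl rfl
  | step hux hadj h =>
    obtain rfl : _ = m := Nat.succ_injective hM
    exact Or.inr ⟨_, hux, hadj, h⟩

lemma adj {m : ℕ} {u v : Fin n} (h : MonoPath H m u v) (huv : (v : ℕ) = u + 1) : H.Adj u v := by
  cases h with
  | refl => omega
  | @step _ _ x _ hux hadj h =>
    have h1 := h.le
    have hxv : x = v := Fin.ext (by rw [Fin.lt_def] at hux; rw [Fin.le_def] at h1; omega)
    exact hxv ▸ hadj

lemma reverse {S : Set (Fin n)} {m : ℕ} {i j : Fin n} (h : MonoPath H m i j)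
    (hS : ∀ v, i ≤ v → v ≤ j → v ∈ S) : Hop H S m j i := by
  induction h with
  | refl => exact .refl (hS _ le_rfl le_rfl)
  | @step m u x v hux hadj h ih =>
    exact (ih fun w h1 h2 => hS w (hux.le.trans h1) h2).snoc hadj.symm
      (hS u le_rfl (hux.le.trans h.le))

lemma crosses {S : Set (Fin n)} {u j : Fin n} {r₁ r₂ : ℕ} :
    ∀ {i : Fin n}, MonoPath H (r₁ + r₂) i j → i < u → u ≤ j → (∀ v, i ≤ v → v ≤ j → v ∈ S) →
      (∃ v, u ≤ v ∧ Hop H S r₁ i v) ∨ ∃ v, v < u ∧ Hop H S r₂ j v := by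
  induction r₁ with
  | zero =>
    intro i h hiu huj hS
    rw [zero_add] at h
    exact Or.inr ⟨i, hiu, h.reverse hS⟩
  | succ r₁ ih =>
    intro i h hiu huj hS
    rcases h.cases_succ (m := r₁ + r₂) (by ring) with rfl | ⟨x, hix, hadj, h⟩
    · exact absurd huj (not_le.2 hiu)
    have hi := hS i le_rfl (hix.le.trans h.le)
    rcases le_or_gt u x with hux | hxu
    · exact Or.inl ⟨x, hux, .step hi hadj (.refl (hS x hix.le h.le))⟩
    · rcases ih h hxu huj fun v h1 h2 => hS v (hix.le.trans h1) h2 with ⟨v, hv, hh⟩ | h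
      · exact Or.inl ⟨v, hv, .step hi hadj hh⟩
      · exact Or.inr h

lemma reaches_or_conn {S : Set (Fin n)} (P : Finset (Fin n)) {m : ℕ} {i j : Fin n}
    (h : MonoPath H m i j) (hS : ∀ v, i ≤ v → v ≤ j → v ∈ S) :
    (∃ v ∈ P, Hop H S m j v) ∨ ∃ C, Conn H C ∧ (∀ v ∈ C, v ∉ P) ∧ i ∈ C ∧ j ∈ C := by
  induction h with
  | @refl m u =>
    by_cases hu : u ∈ P
    · exact Or.inl ⟨u, hu, .refl (hS u le_rfl le_rfl)⟩
    · exact Or.inr ⟨{u}, Conn.singleton u, by rintro v rfl; exact hu, rfl, rfl⟩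
  | @step m u x v hux hadj h ih =>
    by_cases hu : u ∈ P
    · exact Or.inl ⟨u, hu, (MonoPath.step hux hadj h).reverse hS⟩
    · rcases ih fun w h1 h2 => hS w (hux.le.trans h1) h2 with
        ⟨w, hw, hh⟩ | ⟨C, hC, hCP, hxC, hvC⟩
      · exact Or.inl ⟨w, hw, hh.mono_length (Nat.le_succ m)⟩
      · refine Or.inr ⟨{u} ∪ C, (Conn.singleton u).union_of_adj hC rfl hxC hadj, ?_,
          Or.inl rfl, Or.inr hvC⟩
        rintro w (rfl | hw)
        · exact hu
        · exact hCP w hw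

lemma reaches_or_reaches_or_conn {S : Set (Fin n)} (P : Finset (Fin n)) {j : Fin n} {r₁ r₂ : ℕ} :
    ∀ {i : Fin n}, MonoPath H (r₁ + r₂ + 1) i j → (∀ v, i ≤ v → v ≤ j → v ∈ S) →
      (∃ v ∈ P, Hop H S r₁ i v) ∨ (∃ v ∈ P, Hop H S r₂ j v) ∨
        ∃ C, Conn H C ∧ (∀ v ∈ C, v ∉ P) ∧ i ∈ C ∧ j ∈ C := by
  induction r₁ with
  | zero =>
    intro i h hS
    by_cases hi : i ∈ P
    · exact Or.inl ⟨i, hi, .refl (hS i le_rfl h.le)⟩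
    right
    rcases h.cases_succ (m := r₂) (by ring) with rfl | ⟨x, hix, hadj, h⟩
    · exact Or.inr ⟨{i}, Conn.singleton i, by rintro v rfl; exact hi, rfl, rfl⟩
    rcases h.reaches_or_conn P fun v h1 h2 => hS v (hix.le.trans h1) h2 with
      h | ⟨C, hC, hCP, hxC, hjC⟩
    · exact Or.inl h
    · refine Or.inr ⟨{i} ∪ C, (Conn.singleton i).union_of_adj hC rfl hxC hadj, ?_,
        Or.inl rfl, Or.inr hjC⟩
      rintro w (rfl | hw)
      · exact hi
      · exact hCP w hw
  | succ r₁ ih =>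
    intro i h hS
    by_cases hi : i ∈ P
    · exact Or.inl ⟨i, hi, .refl (hS i le_rfl h.le)⟩
    rcases h.cases_succ (m := r₁ + r₂ + 1) (by ring) with rfl | ⟨x, hix, hadj, h⟩
    · exact Or.inr (Or.inr ⟨{i}, Conn.singleton i, by rintro v rfl; exact hi, rfl, rfl⟩)
    rcases ih h fun v h1 h2 => hS v (hix.le.trans h1) h2 with
      ⟨v, hv, hh⟩ | h' | ⟨C, hC, hCP, hxC, hjC⟩
    · exact Or.inl ⟨v, hv, .step (hS i le_rfl (hix.le.trans h.le)) hadj hh⟩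
    · exact Or.inr (Or.inl h')
    · refine Or.inr (Or.inr ⟨{i} ∪ C, (Conn.singleton i).union_of_adj hC rfl hxC hadj, ?_,
        Or.inl rfl, Or.inr hjC⟩)
      rintro w (rfl | hw)
      · exact hi
      · exact hCP w hw

lemma sub_le_sum_lineDist : ∀ (m : ℕ) (x : Fin (m + 1) → Fin n),
    ((x (Fin.last m) : ℕ) : ℝ) - (x 0 : ℕ) ≤ ∑ i : Fin m, lineDist n (x i.castSucc) (x i.succ)
  | 0, x => by simp
  | m + 1, x => by
    have ih := sub_le_sum_lineDist m fun i => x i.succ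
    have h1 := neg_abs_le (((x 0 : ℕ) : ℝ) - (x (Fin.succ 0) : ℕ))
    rw [Fin.sum_univ_succ]
    simp only [Fin.succ_last, Fin.succ_castSucc, Fin.castSucc_zero] at ih ⊢
    unfold lineDist at *
    linarith

lemma of_sum_lineDist : ∀ (m k : ℕ) (x : Fin (m + 1) → Fin n), m ≤ k →
    (∀ i : Fin m, H.Adj (x i.castSucc) (x i.succ)) →
    ∑ i : Fin m, lineDist n (x i.castSucc) (x i.succ) ≤
      ((x (Fin.last m) : ℕ) : ℝ) - (x 0 : ℕ) → MonoPath H k (x 0) (x (Fin.last m))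
  | 0, k, x, _, _, _ => .refl
  | m + 1, 0, x, hm, _, _ => absurd hm (by omega)
  | m + 1, k + 1, x, hm, hadj, hsum => by
    have h1 := sub_le_sum_lineDist m fun i => x i.succ
    rw [Fin.sum_univ_succ] at hsum
    have h2 := le_abs_self (((x 0 : ℕ) : ℝ) - (x (Fin.succ 0) : ℕ))
    have h3 := neg_abs_le (((x 0 : ℕ) : ℝ) - (x (Fin.succ 0) : ℕ))
    have h4 := abs_nonneg (((x 0 : ℕ) : ℝ) - (x (Fin.succ 0) : ℕ))
    have ih := of_sum_lineDist m k (fun i => x i.succ) (by omega)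
      (fun i => by simpa using hadj i.succ) (by
        simp only [Fin.succ_last, Fin.succ_castSucc, Fin.castSucc_zero] at hsum ⊢
        unfold lineDist at *
        linarith)
    have h5 : ((x 0 : ℕ) : ℝ) ≤ (x (Fin.succ 0) : ℕ) := by
      simp only [Fin.succ_last, Fin.succ_castSucc, Fin.castSucc_zero] at hsum h1
      unfold lineDist at *
      linarith
    have h6 := hadj 0
    refine .step (lt_of_le_of_ne (Fin.le_def.2 (by exact_mod_cast h5)) h6.ne) h6 ?_
    simpa using ih

end MonoPath

lemma monoPath_of_isOneSpannerHop {k : ℕ} (hH : IsOneSpannerHop H (lineDist n) k) {u v : Fin n}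
    (huv : u ≤ v) : MonoPath H k u v := by
  obtain ⟨m, x, hm, rfl, rfl, hadj, hsum⟩ := hH u v
  refine MonoPath.of_sum_lineDist m k x hm hadj ?_
  rw [hsum, lineDist, abs_sub_comm, abs_of_nonneg]
  exact sub_nonneg.2 (by exact_mod_cast huv)

/-- The vertices `v` with `a ≤ v < b`. -/
def interval (n a b : ℕ) : Finset (Fin n) := Finset.univ.filter fun v => a ≤ v.val ∧ v.val < b

@[simp]
lemma mem_interval {a b : ℕ} {v : Fin n} : v ∈ interval n a b ↔ a ≤ v.val ∧ v.val < b := by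
  simp [interval]

lemma interval_subset {a b a' b' : ℕ} (ha : a ≤ a') (hb : b' ≤ b) :
    (interval n a' b' : Set (Fin n)) ⊆ interval n a b := by
  intro v hv
  rw [Finset.mem_coe, mem_interval] at *
  omega

lemma conn_interval {k : ℕ} (hH : ∀ u v : Fin n, u ≤ v → MonoPath H k u v) (a b : ℕ) :
    Conn H (interval n a b : Set (Fin n)) := by
  intro S x hx hxS hcl
  simp only [Finset.mem_coe, mem_interval] at hx hcl
  have hup : ∀ d (y : Fin n), y.val = x.val + d → y.val < b → y ∈ S := by
    intro d
    induction d with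
    | zero => intro y hy _; rwa [Fin.ext (a := y) (b := x) (by omega)]
    | succ d ih =>
      intro y hy hyb
      have hy' : x.val + d < n := by have := y.isLt; omega
      have h1 := ih ⟨x.val + d, hy'⟩ rfl (by simp; omega)
      exact hcl _ ⟨by simp; omega, by simp; omega⟩ h1 y ⟨by omega, hyb⟩
        ((hH _ y (Fin.le_def.2 (by simp; omega))).adj (by simp; omega))
  have hdown : ∀ d (y : Fin n), y.val + d = x.val → a ≤ y.val → y ∈ S := by
    intro d
    induction d with
    | zero => intro y hy _; rwa [Fin.ext (a := y) (b := x) (by omega)]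
    | succ d ih =>
      intro y hy hyb
      have hy' : y.val + 1 < n := by have := x.isLt; omega
      have h1 := ih ⟨y.val + 1, hy'⟩ (by simp; omega) (by simp; omega)
      exact hcl _ ⟨by simp; omega, by simp; omega⟩ h1 y ⟨by omega, by omega⟩
        ((hH y ⟨y.val + 1, hy'⟩ (Fin.le_def.2 (by simp))).adj (by simp)).symm
  intro y hy
  rw [Finset.mem_coe, mem_interval] at hy
  rcases le_total x y with h | h
  · exact hup (y.val - x.val) y (by rw [Fin.le_def] at h; omega) hy.2
  · exact hdown (x.val - y.val) y (by rw [Fin.le_def] at h; omega) hy.1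

lemma Config.insert_blob {V : Type} [DecidableEq V] {G : SimpleGraph V} {I I' : Set V}
    {D : Finset (Finset V)} {A : Finset V} (h : Config G I D) (hI' : Conn G I') (hsub : I' ⊆ I)
    (hA : Conn G (A : Set V)) (hAI : (A : Set V) ⊆ I) (hdisj : ∀ v ∈ I', v ∉ A) :
    Config G I' (insert A D) := by
  refine ⟨hI', ?_, ?_, ?_⟩
  · rintro v hv ⟨B, hB, hvB⟩
    rcases Finset.mem_insert.1 hB with rfl | hB
    · exact hdisj v hv hvB
    · exact h.disj v (hsub hv) ⟨B, hB, hvB⟩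
  · intro B hB
    rcases Finset.mem_insert.1 hB with rfl | hB
    · exact hA
    · exact h.conn_of_mem B hB
  · intro B hB C hC v hvB hvC
    rcases Finset.mem_insert.1 hB with rfl | hBD <;> rcases Finset.mem_insert.1 hC with rfl | hCD
    · rfl
    · exact absurd ⟨C, hCD, hvC⟩ (h.disj v (hAI hvB))
    · exact absurd ⟨B, hBD, hvB⟩ (h.disj v (hAI hvC))
    · exact h.eq_of_mem B hBD C hCD v hvB hvC

lemma ncard_insert_far_le {V : Type} [DecidableEq V] {G : SimpleGraph V} {X Y : Set V}
    {D : Finset (Finset V)} {A P : Finset V} (hXY : X ⊆ Y) {u : V} (hu : u ∈ A) (huP : u ∈ P) :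
    {B | B ∈ insert A D ∧ Touches G X B ∧ ∀ v ∈ B, v ∉ P}.ncard ≤
      {B | B ∈ D ∧ Touches G Y B ∧ ∀ v ∈ B, v ∉ P}.ncard := by
  refine Set.ncard_le_ncard ?_ (finite_sep _ _)
  rintro B ⟨hB, ht, hBP⟩
  rcases Finset.mem_insert.1 hB with rfl | hB
  · exact absurd huP (hBP u hu)
  · exact ⟨hB, ht.mono hXY, hBP⟩

lemma exists_split {r : ℕ} (hH : ∀ u v : Fin n, u ≤ v → MonoPath H (r + r) u v) {a b L : ℕ}
    {D : Finset (Finset (Fin n))} (h : Config H (interval n a b : Set (Fin n)) D) (u : Fin n)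
    (hau : a + L ≤ u) (hub : u + L < b) :
    ∃ a' A, a ≤ a' ∧ a' + L ≤ b ∧ u ∈ A ∧
      Config H (interval n a' (a' + L) : Set (Fin n)) (insert A D) ∧
      Gain H r (interval n a b) D (interval n a' (a' + L)) (insert A D) := by
  by_cases hleft : ∀ v ∈ interval n a u, ∃ w, u ≤ w ∧ Hop H (interval n a b : Set (Fin n)) r v w
  · refine ⟨a, interval n u b, le_rfl, by omega, by simp; omega,
      h.insert_blob (conn_interval hH _ _) (interval_subset (by omega) (by omega))
        (conn_interval hH _ _) (interval_subset (by omega) (by omega)) ?_,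
      ⟨interval_subset (by omega) (by omega), Finset.subset_insert _ _, ?_⟩⟩
    · intro v hv
      simp only [Finset.mem_coe, mem_interval] at *
      omega
    · intro v hv
      simp only [Finset.mem_coe, mem_interval] at hv
      obtain ⟨w, hw, hvw⟩ := hleft v (by simp; omega)
      have h1 := hvw.right_mem
      simp only [Finset.mem_coe, mem_interval] at h1
      exact ⟨w, ⟨_, Finset.mem_insert_self _ _, by simpa using ⟨hw, h1.2⟩⟩, hvw⟩
  · push Not at hleft
    obtain ⟨i, hi, hbad⟩ := hleft
    simp only [mem_interval] at hi
    refine ⟨b - L, interval n a (u + 1), by omega, by omega, by simp; omega,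
      h.insert_blob (conn_interval hH _ _) (interval_subset (by omega) (by omega))
        (conn_interval hH _ _) (interval_subset (by omega) (by omega)) ?_,
      ⟨interval_subset (by omega) (by omega), Finset.subset_insert _ _, ?_⟩⟩
    · intro v hv
      simp only [Finset.mem_coe, mem_interval] at *
      omega
    · intro j hj
      simp only [Finset.mem_coe, mem_interval] at hj
      rcases (hH i j (Fin.le_def.2 (by omega))).crosses (u := u)
        (S := (interval n a b : Set (Fin n))) (Fin.lt_def.2 hi.2) (Fin.le_def.2 (by omega))
        (by
          intro v h1 h2
          rw [Fin.le_def] at h1 h2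
          simp only [Finset.mem_coe, mem_interval]
          omega) with ⟨w, hw, hiw⟩ | ⟨w, hw, hjw⟩
      · exact absurd hiw (hbad w hw)
      · have h1 := hjw.right_mem
        simp only [Finset.mem_coe, mem_interval] at h1
        rw [Fin.lt_def] at hw
        exact ⟨w, ⟨_, Finset.mem_insert_self _ _, by simp; omega⟩, hjw⟩

/-- The invariant of the iteration for even hop-diameter. -/
structure EvenInv (H : SimpleGraph (Fin n)) (s e : ℕ)
    (x : Set (Fin n) × Finset (Finset (Fin n)) × Finset (Fin n)) : Prop where
  exists_eq : ∃ a, a + 7 ^ e ≤ n ∧ x.1 = interval n a (a + 7 ^ e)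
  valid : Config H x.1 x.2.1
  card_le : x.2.2.card ≤ 2 * s
  balanced : Balanced H x.1 x.2.1 x.2.2 (2 * s)
  far_le : {A | A ∈ x.2.1 ∧ Touches H (region H x.1 x.2.1) A ∧ ∀ v ∈ A, v ∉ x.2.2}.ncard ≤ 4 * s

lemma nonempty_interval {a b : ℕ} (hab : a < b) (hb : b ≤ n) :
    (interval n a b : Set (Fin n)).Nonempty :=
  ⟨⟨a, by omega⟩, by simp; omega⟩

lemma boundary_le_of_far_le {V : Type} {G : SimpleGraph V} {I : Set V} {D : Finset (Finset V)}
    {P : Finset V} {a b : ℕ} (h : Config G I D) (hP : P.card ≤ b)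
    (hfar : {A | A ∈ D ∧ Touches G (region G I D) A ∧ ∀ v ∈ A, v ∉ P}.ncard ≤ a) :
    boundary G I D ≤ a + b := by
  have h2 := h.ncard_hit_le P
  refine (Set.ncard_le_ncard (t := {A | A ∈ D ∧ Touches G (region G I D) A ∧ ∀ v ∈ A, v ∉ P} ∪
    {A | A ∈ D ∧ ∃ v ∈ A, v ∈ P}) ?_ ((finite_sep _ _).union (finite_sep _ _))).trans
    ((Set.ncard_union_le _ _).trans (by omega))
  rintro A ⟨hA, hAt⟩
  by_cases hAP : ∃ v ∈ A, v ∈ P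
  · exact Or.inr ⟨hA, hAP⟩
  · push Not at hAP
    exact Or.inl ⟨hA, hAt, hAP⟩

/-- Splitting an interval at a vertex of the balanced set preserves the invariant. -/
lemma exists_evenInv_of_mem {r s e a b : ℕ}
    (hH : ∀ u v : Fin n, u ≤ v → MonoPath H (r + r) u v) {D : Finset (Finset (Fin n))}
    {P : Finset (Fin n)} (h : Config H (interval n a b : Set (Fin n)) D) (hb : b ≤ n)
    (hP : P.card ≤ 2 * s) (hbal : Balanced H (interval n a b : Set (Fin n)) D P (2 * s))
    (hfar : {A | A ∈ D ∧ Touches H (region H (interval n a b : Set (Fin n)) D) A ∧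
      ∀ v ∈ A, v ∉ P}.ncard ≤ 4 * s)
    {u : Fin n} (hu : u ∈ P) (hau : a + 7 ^ e ≤ u) (hub : u + 7 ^ e < b) :
    ∃ y, EvenInv H s e y ∧ Gain H r (interval n a b) D y.1 y.2.1 := by
  obtain ⟨a', A, haa', hab', huA, hcfg, hgain⟩ := exists_split hH h u hau hub
  have hX := region_mono (G := H) hgain.subset hgain.dead_subset
  exact ⟨(interval n a' (a' + 7 ^ e), insert A D, P),
    ⟨⟨a', by omega, rfl⟩, hcfg, hP,
      fun C hC hCX hCP => (ncard_insert_far_le subset_rfl huA hu).trans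
        (hbal C hC (hCX.trans hX) hCP),
      (ncard_insert_far_le hX huA hu).trans hfar⟩, hgain⟩

lemma EvenInv.exists_step {r s e : ℕ} (hsep : HasSeparators H s)
    (hH : ∀ u v : Fin n, u ≤ v → MonoPath H (r + r) u v)
    {x : Set (Fin n) × Finset (Finset (Fin n)) × Finset (Fin n)} (hx : EvenInv H s (e + 1) x) :
    ∃ y, EvenInv H s e y ∧ Gain H r x.1 x.2.1 y.1 y.2.1 := by
  obtain ⟨I, D, P⟩ := x
  obtain ⟨⟨a, han, hI⟩, hcfg, hP, hbal, hfar⟩ := hx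
  dsimp only at *
  subst hI
  have hL : 0 < 7 ^ e := by positivity
  rw [pow_succ] at han hcfg hbal hfar ⊢
  by_cases hex : ∃ u ∈ P, a + 7 ^ e ≤ u.val ∧ u.val < a + 6 * 7 ^ e
  · obtain ⟨u, hu, h1, h2⟩ := hex
    exact exists_evenInv_of_mem hH hcfg han hP hbal hfar hu h1 (by omega)
  · push Not at hex
    obtain ⟨D₁, hD₁, hcfg₁, hb₁, -⟩ := hcfg.exists_cut hbal hP
      (K := (interval n (a + 7 ^ e) (a + 6 * 7 ^ e) : Set (Fin n)))
      (interval_subset (by omega) (by omega)) (conn_interval hH _ _) (by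
        intro v hv hvP
        rw [Finset.mem_coe, mem_interval] at hv
        have := hex v hvP hv.1
        omega)
    have hlt : ∀ t : Fin 5, a + (t.val + 1) * 7 ^ e < n := by
      intro t
      have : (t.val + 1) * 7 ^ e ≤ 5 * 7 ^ e := Nat.mul_le_mul_right _ (by omega)
      omega
    obtain ⟨P₁, hP₁, hp, hbal₁⟩ := hsep.exists_balanced hcfg₁ hb₁ fun t => ⟨_, hlt t⟩
    obtain ⟨u, hu, hu₁, hu₂⟩ :
        ∃ u ∈ P₁, a + 2 * 7 ^ e ≤ u.val ∧ u.val < a + 5 * 7 ^ e := by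
      by_contra! hno
      have h1 := hp _ (conn_interval hH (a + 2 * 7 ^ e) (a + 5 * 7 ^ e)) (by
        intro v hv hvP
        rw [Finset.mem_coe, mem_interval] at hv
        have := hno v hvP hv.1
        omega)
      have h2 : (({1, 2, 3} : Finset (Fin 5)) : Set (Fin 5)).ncard ≤ {t : Fin 5 |
          (⟨a + (t.val + 1) * 7 ^ e, hlt t⟩ : Fin n) ∈
            (interval n (a + 2 * 7 ^ e) (a + 5 * 7 ^ e) : Set (Fin n))}.ncard := by
        refine Set.ncard_le_ncard ?_ (Set.toFinite _)
        intro t ht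
        simp only [Set.mem_ofPred_eq, Finset.mem_coe, mem_interval]
        simp only [Finset.mem_coe, Finset.mem_insert, Finset.mem_singleton] at ht
        rcases ht with rfl | rfl | rfl <;> simp
      rw [Set.ncard_coe_finset] at h2
      have h3 : ({1, 2, 3} : Finset (Fin 5)).card = 3 := rfl
      omega
    have hfar₁ : {A | A ∈ D₁ ∧ Touches H (region H (interval n (a + 7 ^ e) (a + 6 * 7 ^ e) :
        Set (Fin n)) D₁) A ∧ ∀ v ∈ A, v ∉ P₁}.ncard ≤ 4 * s := by
      refine le_trans ?_ hb₁
      exact Set.ncard_le_ncard (fun A hA => ⟨hA.1, hA.2.1⟩) (finite_sep _ _)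
    obtain ⟨y, hy, hg⟩ := exists_evenInv_of_mem hH hcfg₁ (by omega) hP₁ hbal₁ hfar₁ hu
      (e := e) (by omega) (by omega)
    have hsub := interval_subset (n := n) (a := a) (b := a + 7 ^ e * 7) (a' := a + 7 ^ e)
      (b' := a + 6 * 7 ^ e) (by omega) (by omega)
    refine ⟨y, hy, hg.subset.trans hsub, hD₁.trans hg.dead_subset, fun v hv => ?_⟩
    obtain ⟨w, hw, hvw⟩ := hg.reach v hv
    exact ⟨w, hw, hvw.mono hsub⟩

lemma succ_le_choose_of_even {r s Q : ℕ} (hsep : HasSeparators H s)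
    (hH : ∀ u v : Fin n, u ≤ v → MonoPath H (r + r) u v) (hQ : 7 ^ Q ≤ n) :
    Q + 1 ≤ (6 * s + r).choose r := by
  have hinit : EvenInv H s Q (interval n 0 (0 + 7 ^ Q), ∅, ∅) :=
    ⟨⟨0, by omega, rfl⟩,
      ⟨conn_interval hH _ _, by rintro v - ⟨A, hA, -⟩; simp at hA, by simp, by simp⟩,
      by simp, fun C _ _ _ => by simp, by simp⟩
  refine succ_le_choose_of_steps (G := H) (Inv := EvenInv H s) ?_
    (fun e x hx => hx.exists_step hsep hH) hinit
  intro e x hx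
  refine ⟨hx.valid, ?_, (boundary_le_of_far_le hx.valid hx.card_le hx.far_le).trans (by omega)⟩
  obtain ⟨a, han, hI⟩ := hx.exists_eq
  rw [hI]
  exact nonempty_interval (Nat.lt_add_of_pos_right (by positivity)) han

lemma exists_block {r s a L : ℕ} (hsep : HasSeparators H s)
    (hH : ∀ u v : Fin n, u ≤ v → MonoPath H (r + r + 1) u v) (hL : 0 < L)
    {D : Finset (Finset (Fin n))} (han : a + L * (4 * s + 1) ≤ n)
    (h : Config H (interval n a (a + L * (4 * s + 1)) : Set (Fin n)) D)
    (hb : boundary H (interval n a (a + L * (4 * s + 1)) : Set (Fin n)) D ≤ 4 * s) :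
    ∃ a' D', a ≤ a' ∧ a' + L ≤ a + L * (4 * s + 1) ∧
      Config H (interval n a' (a' + L) : Set (Fin n)) D' ∧
      boundary H (interval n a' (a' + L) : Set (Fin n)) D' ≤ 4 * s ∧
      Gain H r (interval n a (a + L * (4 * s + 1))) D (interval n a' (a' + L)) D' := by
  classical
  have hlast : ∀ t : Fin (4 * s + 1), L * t.val + L ≤ L * (4 * s + 1) := fun t => by
    rw [← Nat.mul_succ]
    exact Nat.mul_le_mul_left _ t.isLt
  have hlt : ∀ t : Fin (4 * s + 1), a + L * t.val < n := fun t => by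
    have := hlast t
    omega
  obtain ⟨P, hP, hp, hbal⟩ := hsep.exists_balanced h hb fun t => ⟨_, hlt t⟩
  have hpmem : ∀ t : Fin (4 * s + 1), (⟨a + L * t.val, hlt t⟩ : Fin n) ∈
      interval n (a + L * t.val) (a + L * t.val + L) := fun t => by simp; omega
  set I := (interval n a (a + L * (4 * s + 1)) : Set (Fin n)) with hI
  have hblock : ∀ t : Fin (4 * s + 1),
      (interval n (a + L * t.val) (a + L * t.val + L) : Set (Fin n)) ⊆ I := fun t =>
    interval_subset (by omega) (by have := hlast t; omega)
  obtain ⟨t, htP, htr⟩ : ∃ t : Fin (4 * s + 1),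
      (∀ v ∈ interval n (a + L * t.val) (a + L * t.val + L), v ∉ P) ∧
      ∀ u ∈ interval n (a + L * t.val) (a + L * t.val + L), ∃ v ∈ P, Hop H I r u v := by
    by_contra! hno
    set T := Finset.univ.filter fun t : Fin (4 * s + 1) =>
      ∀ v ∈ interval n (a + L * t.val) (a + L * t.val + L), v ∉ P with hT
    have hTc : Tᶜ.card ≤ P.card := by
      have hhit : ∀ t : Fin (4 * s + 1), ∃ v, t ∈ Tᶜ →
          v ∈ interval n (a + L * t.val) (a + L * t.val + L) ∧ v ∈ P := by
        intro t
        by_cases ht : t ∈ T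
        · exact ⟨⟨_, hlt t⟩, fun h => absurd ht (Finset.mem_compl.1 h)⟩
        · have ht' := ht
          simp only [hT, Finset.mem_filter, Finset.mem_univ, true_and] at ht'
          push Not at ht'
          obtain ⟨v, hv⟩ := ht'
          exact ⟨v, fun _ => hv⟩
      choose f hf using hhit
      refine Finset.card_le_card_of_injOn f (fun t ht => (hf t ht).2) ?_
      intro t ht t' ht' htt
      have h1 := (hf t ht).1
      have h2 := (hf t' ht').1
      rw [← htt] at h2
      simp only [mem_interval] at h1 h2
      have key : ∀ x y z : ℕ, L * x ≤ z → z < L * y + L → x ≤ y := by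
        intro x y z h3 h4
        by_contra! h5
        have := Nat.mul_le_mul_left L (Nat.succ_le_of_lt h5)
        rw [Nat.mul_succ] at this
        omega
      exact Fin.ext (le_antisymm (key _ _ ((f t).val - a) (by omega) (by omega))
        (key _ _ ((f t).val - a) (by omega) (by omega)))
    have hTcard : 2 * s + 1 ≤ T.card := by
      have := Finset.card_add_card_compl T
      rw [Fintype.card_fin] at this
      omega
    have hbad : ∀ t : Fin (4 * s + 1), ∃ u, t ∈ T →
        u ∈ interval n (a + L * t.val) (a + L * t.val + L) ∧ ∀ v ∈ P, ¬ Hop H I r u v := by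
      intro t
      by_cases ht : t ∈ T
      · obtain ⟨u, hu⟩ := hno t (Finset.mem_filter.1 ht).2
        exact ⟨u, fun _ => hu⟩
      · exact ⟨⟨_, hlt t⟩, fun h => absurd h ht⟩
    choose u hu using hbad
    obtain ⟨t₀, ht₀⟩ : T.Nonempty := Finset.card_pos.1 (by omega)
    have hjoin : ∀ t ∈ T, ∀ t' ∈ T, u t ≤ u t' →
        ∃ C, Conn H C ∧ (∀ v ∈ C, v ∉ P) ∧ u t ∈ C ∧ u t' ∈ C := by
      intro t ht t' ht' hle
      have h1 := hblock t (hu t ht).1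
      have h2 := hblock t' (hu t' ht').1
      rcases (hH _ _ hle).reaches_or_reaches_or_conn (S := I) P (by
        intro v hv hv'
        rw [Fin.le_def] at hv hv'
        simp only [hI, Finset.mem_coe, mem_interval] at h1 h2 ⊢
        omega) with ⟨v, hv, hh⟩ | ⟨v, hv, hh⟩ | hC
      · exact absurd hh ((hu t ht).2 v hv)
      · exact absurd hh ((hu t' ht').2 v hv)
      · exact hC
    set κ := {C : Set (Fin n) // Conn H C ∧ (∀ v ∈ C, v ∉ P) ∧ u t₀ ∈ C}
    have h1 := hp (⋃ C : κ, C.1) (Conn.iUnion_of_mem (fun C => C.2.1) fun C => C.2.2.2) (by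
      intro v hv
      obtain ⟨C, hC⟩ := Set.mem_iUnion.1 hv
      exact C.2.2.1 v hC)
    have h2 : (T : Set (Fin (4 * s + 1))).ncard ≤
        {t : Fin (4 * s + 1) | (⟨a + L * t.val, hlt t⟩ : Fin n) ∈ ⋃ C : κ, C.1}.ncard := by
      refine Set.ncard_le_ncard ?_ (Set.toFinite _)
      intro t ht
      rw [Finset.mem_coe] at ht
      obtain ⟨C, hC, hCP, htC, ht₀C⟩ :
          ∃ C, Conn H C ∧ (∀ v ∈ C, v ∉ P) ∧ u t ∈ C ∧ u t₀ ∈ C := by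
        rcases le_total (u t) (u t₀) with hle | hle
        · exact hjoin t ht t₀ ht₀ hle
        · obtain ⟨C, hC, hCP, h1, h2⟩ := hjoin t₀ ht₀ t ht hle
          exact ⟨C, hC, hCP, h2, h1⟩
      refine Set.mem_iUnion.2 ⟨⟨C ∪ interval n (a + L * t.val) (a + L * t.val + L),
        hC.union_of_mem (conn_interval hH _ _) htC (hu t ht).1, ?_, Or.inl ht₀C⟩,
        Or.inr (hpmem t)⟩
      rintro v (hv | hv)
      · exact hCP v hv
      · exact (Finset.mem_filter.1 ht).2 v hv
    rw [Set.ncard_coe_finset] at h2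
    omega
  obtain ⟨D', hD', hcfg', hb', hdead⟩ := h.exists_cut hbal hP (hblock t) (conn_interval hH _ _) htP
  refine ⟨a + L * t.val, D', by omega, by have := hlast t; omega, hcfg', hb',
    hblock t, hD', fun v hv => ?_⟩
  obtain ⟨w, hw, hvw⟩ := htr v hv
  exact ⟨w, hdead w hvw.right_mem hw, hvw⟩

lemma succ_le_choose_of_odd {r s Q : ℕ} (hsep : HasSeparators H s)
    (hH : ∀ u v : Fin n, u ≤ v → MonoPath H (r + r + 1) u v) (hQ : (4 * s + 1) ^ Q ≤ n) :
    Q + 1 ≤ (6 * s + r).choose r := by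
  have hinit : ∃ a, a + (4 * s + 1) ^ Q ≤ n ∧
      (interval n 0 (0 + (4 * s + 1) ^ Q) : Set (Fin n)) =
        interval n a (a + (4 * s + 1) ^ Q) ∧
      Config H (interval n 0 (0 + (4 * s + 1) ^ Q) : Set (Fin n)) ∅ ∧
      boundary H (interval n 0 (0 + (4 * s + 1) ^ Q) : Set (Fin n)) ∅ ≤ 4 * s :=
    ⟨0, by omega, rfl,
      ⟨conn_interval hH _ _, by rintro v - ⟨A, hA, -⟩; simp at hA, by simp, by simp⟩,
      by simp [boundary]⟩
  refine succ_le_choose_of_steps (G := H) (Inv := fun e x => ∃ a, a + (4 * s + 1) ^ e ≤ n ∧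
      x.1 = interval n a (a + (4 * s + 1) ^ e) ∧ Config H x.1 x.2.1 ∧ boundary H x.1 x.2.1 ≤ 4 * s)
    (x := (_, _, ∅)) ?_ ?_ hinit
  · rintro e x ⟨a, han, hI, hcfg, hb⟩
    refine ⟨hcfg, ?_, by omega⟩
    rw [hI]
    exact nonempty_interval (Nat.lt_add_of_pos_right (by positivity)) han
  · rintro e ⟨I, D, P⟩ ⟨a, han, hI, hcfg, hb⟩
    dsimp only at *
    subst hI
    rw [pow_succ] at han hcfg hb ⊢
    obtain ⟨a', D', -, ha', hcfg', hb', hgain⟩ :=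
      exists_block hsep hH (by positivity) han hcfg hb
    exact ⟨(_, D', ∅), ⟨a', by omega, rfl, hcfg', hb'⟩, hgain⟩

end Line

section Numerics

lemma choose_le_exp_mul_pow (m : ℕ) {r : ℕ} (hr : 0 < r) :
    (m.choose r : ℝ) ≤ (Real.exp 1 * m / r) ^ r := by
  have hr' : (0 : ℝ) < r := by exact_mod_cast hr
  have hf : (0 : ℝ) < r.factorial := by exact_mod_cast r.factorial_pos
  have h1 := Nat.choose_le_pow_div (α := ℝ) r m
  have h2 := Real.pow_div_factorial_le_exp (r : ℝ) hr'.le r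
  rw [← mul_one (r : ℝ), Real.exp_nat_mul, mul_one] at h2
  calc (m.choose r : ℝ) ≤ (m : ℝ) ^ r / r.factorial := h1
    _ = (m / r : ℝ) ^ r * ((r : ℝ) ^ r / r.factorial) := by
        rw [div_pow]
        field_simp
    _ ≤ (m / r : ℝ) ^ r * Real.exp 1 ^ r := by gcongr
    _ = (Real.exp 1 * m / r) ^ r := by rw [← mul_pow]; congr 1; ring

lemma log_two_mul_exp_one : Real.log (2 * Real.exp 1) = Real.log 2 + 1 := by
  rw [Real.log_mul two_ne_zero (Real.exp_ne_zero 1), Real.log_exp]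

lemma three_mul_choose_le {r s : ℕ} {N : ℝ} (hr : 2 ≤ r) (hN : 0 < N)
    (hlog : r * Real.log (2 * Real.exp 1) ≤ Real.log N)
    (hs : (s : ℝ) < 1 / 1000 * (2 * r) * N ^ (r : ℝ)⁻¹) :
    3 * ((6 * s + r).choose r : ℝ) ≤ N := by
  have hr' : (0 : ℝ) < r := by exact_mod_cast (by omega : 0 < r)
  set Y := N ^ (r : ℝ)⁻¹ with hY
  have hYpow : Y ^ r = N := Real.rpow_inv_natCast_pow hN.le (by omega)
  have he := Real.exp_one_lt_d9
  have he0 := Real.exp_pos 1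
  have hYlb : 2 * Real.exp 1 ≤ Y := by
    rw [hY, Real.rpow_def_of_pos hN, ← Real.log_le_iff_le_exp (by positivity),
      ← div_eq_mul_inv, le_div_iff₀ hr']
    linarith
  have hbase : Real.exp 1 * ((6 * s + r : ℕ) : ℝ) / r ≤ 0.533 * Y := by
    rw [div_le_iff₀ hr']
    push_cast
    have h1 : Real.exp 1 * (6 * (s : ℝ)) ≤ Real.exp 1 * (6 * (1 / 1000 * (2 * r) * Y)) := by gcongr
    have h2 : Real.exp 1 * r ≤ Y / 2 * r := by gcongr; linarith
    have h3 : Real.exp 1 * (Y * r) ≤ 2.72 * (Y * r) := by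
      have : 0 ≤ Y * r := by positivity
      gcongr
      linarith
    nlinarith [mul_nonneg (by positivity : 0 ≤ Y) hr'.le]
  have hpow : (0.533 : ℝ) ^ r ≤ 0.533 ^ 2 :=
    pow_le_pow_of_le_one (by norm_num) (by norm_num) hr
  calc 3 * ((6 * s + r).choose r : ℝ)
      ≤ 3 * (Real.exp 1 * ((6 * s + r : ℕ) : ℝ) / r) ^ r := by
        gcongr
        exact choose_le_exp_mul_pow _ (by omega)
    _ ≤ 3 * (0.533 * Y) ^ r := by gcongr
    _ = 3 * 0.533 ^ r * N := by rw [mul_pow, hYpow]; ring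
    _ ≤ 3 * 0.533 ^ 2 * N := by gcongr
    _ ≤ 1 * N := by gcongr; norm_num
    _ = N := one_mul N

lemma mul_le_log_div_logb {r : ℕ} {N : ℝ} (hr : 1 ≤ r) (hN : 1 < N)
    (hlog : (r + 1 / 2 : ℝ) * Real.log (2 * Real.exp 1) ≤ Real.log N) :
    1.06 * r ≤ Real.log (N / Real.logb 2 N) := by
  have hr' : (1 : ℝ) ≤ r := by exact_mod_cast hr
  have hu : 0 < Real.log N := Real.log_pos hN
  have hl := Real.log_two_gt_d9
  have hl' := Real.log_two_lt_d9
  rw [log_two_mul_exp_one] at hlog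
  have h1 : Real.log (Real.log N) ≤ Real.log N / 4 + 2 * Real.log 2 - 1 := by
    have h := Real.log_le_sub_one_of_pos (show 0 < Real.log N / 4 by positivity)
    rw [Real.log_div hu.ne' (by norm_num), show (4 : ℝ) = 2 ^ 2 by norm_num, Real.log_pow] at h
    push_cast at h
    linarith
  have h2 : -0.444 ≤ Real.log (Real.log 2) := by
    have h := Real.one_sub_inv_le_log_of_pos (show 0 < Real.log 2 by linarith)
    have h3 : (Real.log 2)⁻¹ ≤ (0.693 : ℝ)⁻¹ := by gcongr; linarith
    have h4 : (0.693 : ℝ)⁻¹ ≤ 1.444 := by norm_num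
    linarith
  rw [Real.logb, Real.log_div (by positivity) (by positivity),
    Real.log_div hu.ne' (by positivity)]
  nlinarith

lemma choose_mul_logb_le {r s : ℕ} {N : ℝ} (hr : 1 ≤ r) (hN : 1 < N)
    (hlog : (r + 1 / 2 : ℝ) * Real.log (2 * Real.exp 1) ≤ Real.log N)
    (hs : (s : ℝ) < 1 / 1000 * (2 * r + 1) * (N / Real.logb 2 N) ^ (r : ℝ)⁻¹) :
    ((6 * s + r).choose r : ℝ) * Real.logb 2 (4 * s + 1) ≤ N := by
  have hr' : (1 : ℝ) ≤ r := by exact_mod_cast hr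
  have hu : 0 < Real.log N := Real.log_pos hN
  have hl := Real.log_two_gt_d9
  have hl' := Real.log_two_lt_d9
  have he := Real.exp_one_lt_d9
  have he' := Real.exp_one_gt_d9
  have hlogb : 1 ≤ Real.logb 2 N := by
    rw [Real.logb, le_div_iff₀ (by linarith)]
    rw [log_two_mul_exp_one] at hlog
    nlinarith
  have hN2 : 2 ≤ N := by
    rw [Real.le_logb_iff_rpow_le one_lt_two (by linarith), Real.rpow_one] at hlogb
    exact hlogb
  have hM : 0 < N / Real.logb 2 N := by positivity
  set Y := (N / Real.logb 2 N) ^ (r : ℝ)⁻¹ with hY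
  have hYpow : Y ^ r = N / Real.logb 2 N := Real.rpow_inv_natCast_pow hM.le (by omega)
  have hYlb : 1.06 * Real.exp 1 ≤ Y := by
    have h1 : (1.06 : ℝ) ≤ Real.log (N / Real.logb 2 N) * (r : ℝ)⁻¹ := by
      rw [← div_eq_mul_inv, le_div_iff₀ (by linarith)]
      exact mul_le_log_div_logb hr hN hlog
    rw [hY, Real.rpow_def_of_pos hM]
    refine le_trans ?_ (Real.exp_le_exp.2 h1)
    rw [show (1.06 : ℝ) = 0.06 + 1 by norm_num, Real.exp_add]
    gcongr
    exact Real.add_one_le_exp _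
  have hY2 : 2 ≤ Y := by linarith
  have hs' : (s : ℝ) ≤ 0.003 * (r * Y) := by nlinarith
  have hbase : Real.exp 1 * ((6 * s + r : ℕ) : ℝ) / r ≤ Y := by
    rw [div_le_iff₀ (by linarith)]
    push_cast
    have h1 : Real.exp 1 * (6 * (s : ℝ)) ≤ Real.exp 1 * (6 * (0.003 * (r * Y))) := by gcongr
    have h2 : Real.exp 1 * r ≤ 0.944 * Y * r := by gcongr; linarith
    have h3 : Real.exp 1 * (r * Y) ≤ 2.72 * (r * Y) := by gcongr; linarith
    have h4 : 0 ≤ r * Y := by positivity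
    linarith
  have hchoose : ((6 * s + r).choose r : ℝ) ≤ N / Real.logb 2 N := by
    rw [← hYpow]
    refine (choose_le_exp_mul_pow _ (by omega)).trans ?_
    gcongr
  have hrY : r * Y ≤ N := by
    obtain ⟨q, rfl⟩ := Nat.exists_eq_add_of_le' hr
    have h1 : ((q + 1 : ℕ) : ℝ) ≤ Y ^ q := by
      calc ((q + 1 : ℕ) : ℝ) ≤ ((2 ^ q : ℕ) : ℝ) := by exact_mod_cast Nat.lt_two_pow_self
        _ = 2 ^ q := by push_cast; rfl
        _ ≤ Y ^ q := by gcongr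
    calc ((q + 1 : ℕ) : ℝ) * Y ≤ Y ^ q * Y := by gcongr
      _ = N / Real.logb 2 N := by rw [← pow_succ, hYpow]
      _ ≤ N := div_le_self (by linarith) hlogb
  have hs4 : (4 * s + 1 : ℝ) ≤ N := by linarith
  calc ((6 * s + r).choose r : ℝ) * Real.logb 2 (4 * s + 1)
      ≤ N / Real.logb 2 N * Real.logb 2 N := by
        gcongr
        · exact Real.logb_nonneg one_lt_two (by linarith [(Nat.cast_nonneg s : (0 : ℝ) ≤ s)])
        · norm_num
    _ = N := div_mul_cancel₀ _ (by positivity)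

lemma one_lt_of_pos_le_mul_log {c k : ℝ} {N : ℝ} (hc : 0 < c) (hk : 0 < k) (hN : 0 ≤ N)
    (h : k ≤ c * Real.log N) : 1 < N := by
  by_contra! hle
  have := Real.log_nonpos hN hle
  nlinarith

lemma logb_lt_of_forall_pow_le {n m C : ℕ} (hn : 0 < n)
    (h : ∀ Q, m ^ Q ≤ n → Q + 1 ≤ C) : Real.logb 2 n < C * Real.logb 2 m := by
  have hlt : n < m ^ C := by
    by_contra! hle
    have := h C hle
    omega
  rw [← Real.logb_pow]
  exact Real.logb_lt_logb one_lt_two (by exact_mod_cast hn) (by exact_mod_cast hlt)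

end Numerics

lemma treewidthGE_of_not_hasSeparators {V : Type} [Finite V] {G : SimpleGraph V} {y : ℝ}
    (hy : 0 < y) (h : ∀ s : ℕ, (s : ℝ) < y → ¬ HasSeparators G s) : TreewidthGE G (y - 1) := by
  intro ι td
  by_contra! hlt
  have hpos := Nat.ceil_pos.2 hy
  refine h (⌈y⌉₊ - 1) (Nat.lt_ceil.1 (by omega)) (hasSeparators_of_treeDecomp td fun i => ?_)
  have := Nat.lt_ceil.2 (show ((td.bag i).card : ℝ) < y by linarith [hlt i])
  omega

end LineSpanner

/-- There is an absolute constant `c₁ > 0` such that for every `n` and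
every integer `k` with `3 ≤ k ≤ (2/ln(2e))·ln log n`, every 1-spanner of the uniform line
metric on `n` points with hop-diameter `k` has treewidth at least `c₁·k·(log n)^{2/k} − 1`
when `k` is even, and at least `c₁·k·(log n / log log n)^{2/(k-1)} − 1` when `k` is odd. -/
theorem stmt3 :
    ∃ c₁ : ℝ, 0 < c₁ ∧
      ∀ n : ℕ, ∀ k : ℕ, 3 ≤ k →
        (k : ℝ) ≤ 2 / Real.log (2 * Real.exp 1) * Real.log (Real.logb 2 n) →
        ∀ H : SimpleGraph (Fin n), IsOneSpannerHop H (lineDist n) k →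
          (Even k → TreewidthGE H (c₁ * k * Real.logb 2 n ^ ((2 : ℝ) / k) - 1)) ∧
          (Odd k → TreewidthGE H
            (c₁ * k * (Real.logb 2 n / Real.logb 2 (Real.logb 2 n)) ^ ((2 : ℝ) / ((k : ℝ) - 1)) - 1)) := by
  refine ⟨1 / 1000, by norm_num, fun n k hk hkn H hH => ?_⟩
  have hk' : (3 : ℝ) ≤ k := by exact_mod_cast hk
  have he : 0 < Real.log (2 * Real.exp 1) := by
    rw [LineSpanner.log_two_mul_exp_one]
    linarith [Real.log_two_gt_d9]
  have hN0 : 0 ≤ Real.logb 2 n := div_nonneg (Real.log_natCast_nonneg n) (by positivity)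
  have hN : 1 < Real.logb 2 n :=
    LineSpanner.one_lt_of_pos_le_mul_log (by positivity) (by linarith) hN0 hkn
  have hlog : k * Real.log (2 * Real.exp 1) ≤ 2 * Real.log (Real.logb 2 n) := by
    rw [div_mul_eq_mul_div, le_div_iff₀ he] at hkn
    exact hkn
  have hn : 0 < n := by
    rcases Nat.eq_zero_or_pos n with rfl | hn
    · norm_num at hN
    · exact hn
  have hmono : ∀ u v : Fin n, u ≤ v → LineSpanner.MonoPath H k u v :=
    fun u v huv => LineSpanner.monoPath_of_isOneSpannerHop hH huv
  constructor
  · rintro ⟨r, rfl⟩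
    have hexp : (2 : ℝ) / ((r + r : ℕ) : ℝ) = (r : ℝ)⁻¹ := by
      push_cast at hk' ⊢
      have : (r : ℝ) ≠ 0 := by intro h; rw [h] at hk'; norm_num at hk'
      field_simp
      norm_num
    rw [hexp]
    refine LineSpanner.treewidthGE_of_not_hasSeparators (by positivity) fun s hs hsep => ?_
    have h1 := LineSpanner.logb_lt_of_forall_pow_le hn (m := 7) fun Q hQ =>
      LineSpanner.succ_le_choose_of_even hsep hmono hQ
    have h2 := LineSpanner.three_mul_choose_le (r := r) (s := s) (N := Real.logb 2 n)
      (by omega) (by linarith)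
      (by push_cast at hlog; linarith) (by push_cast at hs; rwa [two_mul])
    have h3 : Real.logb 2 ((7 : ℕ) : ℝ) ≤ 3 := by
      rw [Real.logb_le_iff_le_rpow one_lt_two (by norm_num)]
      norm_num
    have h4 : (0 : ℝ) ≤ ((6 * s + r).choose r : ℝ) := Nat.cast_nonneg _
    nlinarith
  · rintro ⟨r, rfl⟩
    have hexp : (2 : ℝ) / (((2 * r + 1 : ℕ) : ℝ) - 1) = (r : ℝ)⁻¹ := by
      push_cast at hk' ⊢
      have : (r : ℝ) ≠ 0 := by intro h; rw [h] at hk'; norm_num at hk'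
      rw [add_sub_cancel_right]
      field_simp
    rw [hexp]
    have hNN : 0 < Real.logb 2 (Real.logb 2 n) := Real.logb_pos one_lt_two hN
    refine LineSpanner.treewidthGE_of_not_hasSeparators (by positivity) fun s hs hsep => ?_
    rw [two_mul] at hmono
    have h1 := LineSpanner.logb_lt_of_forall_pow_le hn (m := 4 * s + 1) fun Q hQ =>
      LineSpanner.succ_le_choose_of_odd hsep hmono hQ
    have h2 := LineSpanner.choose_mul_logb_le (r := r) (s := s) (by omega) hN
      (by push_cast at hlog; linarith) (by push_cast at hs; exact hs)
    push_cast at h1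
    linarith
end

section
/- For every n ≥ 1, every 1-spanner of the uniform line metric on n points with hop-diameter 2 contains the complete graph K_{⌊log n⌋+1} as a minor. -/
open SimpleGraph

/-- `G` has a model of `K_t` as a minor with all branch sets contained in `S`. -/
def HasCliqueMinorIn {V : Type} (G : SimpleGraph V) (S : Set V) (t : ℕ) : Prop :=
  ∃ B : Fin t → Set V,
    (∀ i, B i ⊆ S) ∧
    (∀ i j, i ≠ j → Disjoint (B i) (B j)) ∧
    (∀ i, (G.induce (B i)).Connected) ∧
    (∀ i j, i ≠ j → ∃ u ∈ B i, ∃ v ∈ B j, G.Adj u v)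

/-- A connected set disjoint from `S` to which every vertex of `S` is adjacent
extends any clique-minor model inside `S`. -/
theorem HasCliqueMinorIn.cons {V : Type} {G : SimpleGraph V} {S C U : Set V} {t : ℕ}
    (h : HasCliqueMinorIn G S t) (hC : (G.induce C).Connected) (hdisj : Disjoint C S)
    (hadj : ∀ u ∈ S, ∃ v ∈ C, G.Adj u v) (hSU : S ⊆ U) (hCU : C ⊆ U) :
    HasCliqueMinorIn G U (t + 1) := by
  obtain ⟨B, hBS, hBdisj, hBconn, hBadj⟩ := h
  have key : ∀ i, ∃ u ∈ B i, ∃ v ∈ C, G.Adj u v := fun i ↦ by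
    obtain ⟨u, hu⟩ := (hBconn i).nonempty
    exact ⟨u, hu, hadj u (hBS i hu)⟩
  refine ⟨Fin.cons C B, ?_, ?_, ?_, ?_⟩
  · intro i
    cases i using Fin.cases with
    | zero => simpa using hCU
    | succ i => simpa using (hBS i).trans hSU
  · intro i j hij
    cases i using Fin.cases with
    | zero =>
      cases j using Fin.cases with
      | zero => exact absurd rfl hij
      | succ j => simpa using hdisj.mono_right (hBS j)
    | succ i =>
      cases j using Fin.cases with
      | zero => simpa using (hdisj.mono_right (hBS i)).symm
      | succ j => simpa using hBdisj i j (by simpa using hij)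
  · intro i
    cases i using Fin.cases with
    | zero => exact hC
    | succ i => exact hBconn i
  · intro i j hij
    cases i using Fin.cases with
    | zero =>
      cases j using Fin.cases with
      | zero => exact absurd rfl hij
      | succ j =>
        obtain ⟨u, hu, v, hv, huv⟩ := key j
        exact ⟨v, hv, u, hu, huv.symm⟩
    | succ i =>
      cases j using Fin.cases with
      | zero => exact key i
      | succ j => exact hBadj i j (by simpa using hij)

/-- In a hop-diameter-2 spanner of the line, two distinct points are adjacent or have a
common neighbour strictly between them. -/
theorem IsOneSpannerHop.adj_or_exists_between {n : ℕ} {H : SimpleGraph (Fin n)}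
    (hH : IsOneSpannerHop H (lineDist n) 2) {u v : Fin n} (huv : u < v) :
    H.Adj u v ∨ ∃ k, u < k ∧ k < v ∧ H.Adj u k ∧ H.Adj k v := by
  obtain ⟨m, x, hm, rfl, rfl, hadj, hsum⟩ := hH u v
  interval_cases m
  · exact absurd huv (lt_irrefl _)
  · exact Or.inl (hadj 0)
  · have h₀ : H.Adj (x 0) (x 1) := hadj 0
    have h₁ : H.Adj (x 1) (x 2) := hadj 1
    have hs : lineDist n (x 0) (x 1) + lineDist n (x 1) (x 2) = lineDist n (x 0) (x 2) := by
      simpa [Fin.sum_univ_two] using hsum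
    have hlt : x 0 < x 2 := huv
    have hlt' : ((x 0 : ℕ) : ℝ) < (x 2 : ℕ) := by exact_mod_cast hlt
    simp only [lineDist] at hs
    rw [abs_of_neg (sub_neg.2 hlt')] at hs
    have a₁ := neg_abs_le (((x 0 : ℕ) : ℝ) - (x 1 : ℕ))
    have a₂ := le_abs_self (((x 0 : ℕ) : ℝ) - (x 1 : ℕ))
    have a₃ := neg_abs_le (((x 1 : ℕ) : ℝ) - (x 2 : ℕ))
    have a₄ := le_abs_self (((x 1 : ℕ) : ℝ) - (x 2 : ℕ))
    have b₁ : ((x 0 : ℕ) : ℝ) ≤ (x 1 : ℕ) := by linarith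
    have b₂ : ((x 1 : ℕ) : ℝ) ≤ (x 2 : ℕ) := by linarith
    exact Or.inr ⟨x 1, lt_of_le_of_ne (by exact_mod_cast b₁) h₀.ne,
      lt_of_le_of_ne (by exact_mod_cast b₂) h₁.ne, h₀, h₁⟩

/-- If any two points are adjacent or have a common neighbour between them, then every
nonempty order-convex set of vertices is connected. -/
theorem connected_induce_of_ordConnected {V : Type} [LinearOrder V] {G : SimpleGraph V}
    (hG : ∀ u v, u < v → G.Adj u v ∨ ∃ k, u < k ∧ k < v ∧ G.Adj u k ∧ G.Adj k v)
    {S : Set V} (hS : S.OrdConnected) (hne : S.Nonempty) : (G.induce S).Connected := by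
  have hlt : ∀ u v : S, u < v → (G.induce S).Reachable u v := by
    rintro ⟨u, hu⟩ ⟨v, hv⟩ huv
    obtain h | ⟨k, huk, hkv, h₁, h₂⟩ := hG u v huv
    · exact Adj.reachable (G := G.induce S) h
    · have hk : k ∈ S := hS.out hu hv ⟨huk.le, hkv.le⟩
      exact (Adj.reachable (G := G.induce S) (u := ⟨u, hu⟩) (v := ⟨k, hk⟩) h₁).trans
        (Adj.reachable (G := G.induce S) h₂)
  have := hne.to_subtype
  refine ⟨fun u v ↦ ?_⟩
  obtain h | rfl | h := lt_trichotomy u v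
  · exact hlt u v h
  · exact Reachable.refl _
  · exact (hlt v u h).symm

/-- Every interval of `2 ^ t` points contains a model of `K_{t+1}`. -/
theorem hasCliqueMinorIn_Ico {n : ℕ} {H : SimpleGraph (Fin n)}
    (hH : ∀ u v, u < v → H.Adj u v ∨ ∃ k, u < k ∧ k < v ∧ H.Adj u k ∧ H.Adj k v) (t : ℕ) :
    ∀ a, a + 2 ^ t ≤ n →
      HasCliqueMinorIn H (Fin.val ⁻¹' Set.Ico a (a + 2 ^ t)) (t + 1) := by
  have hconn : ∀ a b, a < b → b ≤ n →
      (H.induce (Fin.val ⁻¹' Set.Ico a b : Set (Fin n))).Connected := fun a b hab hb ↦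
    connected_induce_of_ordConnected hH (Set.ordConnected_Ico.preimage_mono fun _ _ h ↦ h)
      ⟨⟨a, hab.trans_le hb⟩, by simpa using hab⟩
  induction t with
  | zero =>
    intro a ha
    have hc := hconn a (a + 2 ^ 0) (by simp) ha
    exact ⟨fun _ ↦ _, fun _ ↦ subset_rfl,
      fun i j hij ↦ absurd (Subsingleton.elim (α := Fin 1) i j) hij, fun _ ↦ hc,
      fun i j hij ↦ absurd (Subsingleton.elim (α := Fin 1) i j) hij⟩
  | succ t ih =>
    intro a ha
    have hpos : 0 < 2 ^ t := by positivity
    have hpow : a + 2 ^ (t + 1) = a + 2 ^ t + 2 ^ t := by ring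
    rw [hpow] at ha ⊢
    set b := a + 2 ^ t with hb
    set c := b + 2 ^ t with hc
    have hdisj : Disjoint (Fin.val ⁻¹' Set.Ico a b : Set (Fin n)) (Fin.val ⁻¹' Set.Ico b c) :=
      Disjoint.preimage _ (Set.Ico_disjoint_Ico_same)
    have hL : (Fin.val ⁻¹' Set.Ico a b : Set (Fin n)) ⊆ Fin.val ⁻¹' Set.Ico a c :=
      Set.preimage_mono (Set.Ico_subset_Ico_right (by omega))
    have hR : (Fin.val ⁻¹' Set.Ico b c : Set (Fin n)) ⊆ Fin.val ⁻¹' Set.Ico a c :=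
      Set.preimage_mono (Set.Ico_subset_Ico_left (by omega))
    by_cases hadj : ∀ u ∈ (Fin.val ⁻¹' Set.Ico a b : Set (Fin n)),
        ∃ v ∈ (Fin.val ⁻¹' Set.Ico b c : Set (Fin n)), H.Adj u v
    · exact (ih a (by omega)).cons (hconn b c (by omega) ha) hdisj.symm hadj hL hR
    · push Not at hadj
      obtain ⟨u, hu, hun⟩ := hadj
      refine (ih b ha).cons (hconn a b (by omega) (by omega)) hdisj (fun v hv ↦ ?_) hR hL
      simp only [Set.mem_preimage, Set.mem_Ico] at hu hv hun ⊢
      obtain h | ⟨k, huk, hkv, h₁, h₂⟩ := hH u v (Fin.lt_def.2 (by omega))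
      · exact absurd h (hun v hv)
      · rw [Fin.lt_def] at huk hkv
        by_cases hk : (k : ℕ) < b
        · exact ⟨k, ⟨by omega, hk⟩, h₂.symm⟩
        · exact absurd h₁ (hun k ⟨by omega, by omega⟩)

/-- For every `n ≥ 1`, every 1-spanner of the uniform line metric on `n`
points with hop-diameter `2` contains the complete graph `K_{⌊log n⌋ + 1}` as a minor. -/
theorem stmt5 :
    ∀ n : ℕ, 1 ≤ n → ∀ H : SimpleGraph (Fin n),
      IsOneSpannerHop H (lineDist n) 2 → HasCliqueMinor H (Nat.log 2 n + 1) := by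
  intro n hn H hH
  obtain ⟨B, -, hB⟩ := hasCliqueMinorIn_Ico (fun _ _ ↦ hH.adj_or_exists_between)
    (Nat.log 2 n) 0 (by simpa using Nat.pow_log_le_self 2 (by omega))
  exact ⟨B, hB⟩
end

section
/- If every edge of a graph G = (V,E) can be oriented so that every vertex has in-degree at most d, then the edge set of G can be partitioned into at most d+1 forests (i.e., the arboricity of G is at most d+1). -/
open SimpleGraph

section ArcCounting

variable {V : Type} [DecidableEq V]

/-- The arcs of `A` with both ends in `X`. -/
def inducedArcs (A : Finset (V × V)) (X : Finset V) : Finset (V × V) :=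
  {a ∈ A | a.1 ∈ X ∧ a.2 ∈ X}

/-- The arcs of `A` directed into `v`. -/
def arcsInto (A : Finset (V × V)) (v : V) : Finset (V × V) :=
  {a ∈ A | a.2 = v}

theorem inducedArcs_mono {A B : Finset (V × V)} (h : A ⊆ B) (X : Finset V) :
    inducedArcs A X ⊆ inducedArcs B X :=
  Finset.filter_subset_filter _ h

theorem card_inducedArcs_erase_add_one {A : Finset (V × V)} {X : Finset V} {u v : V}
    (ha : (u, v) ∈ A) (hu : u ∈ X) (hv : v ∈ X) :
    (inducedArcs (A.erase (u, v)) X).card + 1 = (inducedArcs A X).card := by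
  have h : inducedArcs (A.erase (u, v)) X = (inducedArcs A X).erase (u, v) := by
    ext; simp [inducedArcs]; tauto
  rw [h, Finset.card_erase_add_one]
  simp [inducedArcs, ha, hu, hv]

theorem card_arcsInto_erase_add_one {A : Finset (V × V)} {u v : V} (ha : (u, v) ∈ A) :
    (arcsInto (A.erase (u, v)) v).card + 1 = (arcsInto A v).card := by
  have h : arcsInto (A.erase (u, v)) v = (arcsInto A v).erase (u, v) := by
    ext; simp [arcsInto]; tauto
  rw [h, Finset.card_erase_add_one]
  simp [arcsInto, ha]

/-- The number of arcs induced by a vertex set is supermodular. -/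
theorem card_inducedArcs_add_card_inducedArcs_le (A : Finset (V × V)) (X Y : Finset V) :
    (inducedArcs A X).card + (inducedArcs A Y).card ≤
      (inducedArcs A (X ∪ Y)).card + (inducedArcs A (X ∩ Y)).card := by
  rw [← Finset.card_union_add_card_inter]
  refine add_le_add (Finset.card_le_card fun a ha => ?_) (Finset.card_le_card fun a ha => ?_)
  · simp only [inducedArcs, Finset.mem_union, Finset.mem_filter] at ha ⊢
    tauto
  · simp only [inducedArcs, Finset.mem_inter, Finset.mem_filter] at ha ⊢
    tauto

theorem card_filter_head_mem_le {A : Finset (V × V)} {T : Finset V} {k : ℕ}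
    (h : ∀ v ∈ T, (arcsInto A v).card ≤ k) :
    (A.filter fun a => a.2 ∈ T).card ≤ k * T.card := by
  refine Finset.card_le_mul_card_image_of_maps_to (f := Prod.snd)
    (fun a ha => (Finset.mem_filter.1 ha).2) k fun v hv => (Finset.card_le_card ?_).trans (h v hv)
  exact Finset.filter_subset_filter _ (Finset.filter_subset _ _)

theorem le_card_filter_head_mem {A : Finset (V × V)} {T : Finset V} {k : ℕ}
    (h : ∀ v ∈ T, k ≤ (arcsInto A v).card) :
    k * T.card ≤ (A.filter fun a => a.2 ∈ T).card := by
  refine Finset.mul_card_image_le_card_of_maps_to (f := Prod.snd)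
    (fun a ha => (Finset.mem_filter.1 ha).2) k fun v hv => (h v hv).trans (Finset.card_le_card ?_)
  intro a ha
  simp only [arcsInto, Finset.mem_filter] at ha ⊢
  exact ⟨⟨ha.1, ha.2 ▸ hv⟩, ha.2⟩

end ArcCounting

section Branching

variable {V : Type} [DecidableEq V] {D A : Finset (V × V)} {k : ℕ} {S : Finset V}
  {F : SimpleGraph V}

/-- A stage in the growth of a branching in `D`. The branching spans `S` and has underlying
forest `F`, the remaining arcs are `A`, and the inequalities ensure that the remaining arcs
can be covered by `k` further branchings once `S` is everything. -/
structure IsPartialBranching (D : Finset (V × V)) (k : ℕ) (S : Finset V) (A : Finset (V × V))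
    (F : SimpleGraph V) : Prop where
  subset : A ⊆ D
  adj_of_notMem : ∀ a ∈ D, a ∉ A → F.Adj a.1 a.2
  mem_or_mem : ∀ u v, F.Adj u v → (u, v) ∈ D ∨ (v, u) ∈ D
  isAcyclic : F.IsAcyclic
  mem_of_adj : ∀ u v, F.Adj u v → u ∈ S
  card_arcsInto_le : ∀ v, (arcsInto A v).card ≤ k + 1
  card_arcsInto_le_of_mem : ∀ v ∈ S, (arcsInto A v).card ≤ k
  sparse : ∀ X : Finset V, X.Nonempty →
    (inducedArcs A X).card + k + (X ∩ S).card ≤ (k + 1) * X.card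

/-- A vertex set for which the sparsity inequality of `IsPartialBranching` is an equality. -/
def IsTight (k : ℕ) (S : Finset V) (A : Finset (V × V)) (X : Finset V) : Prop :=
  (inducedArcs A X).card + k + (X ∩ S).card = (k + 1) * X.card

theorem card_inter_insert_of_mem {X : Finset V} {v : V} (hv : v ∉ S) (hX : v ∈ X) :
    (X ∩ insert v S).card = (X ∩ S).card + 1 := by
  rw [Finset.inter_insert_of_mem hX, Finset.card_insert_of_notMem (by simp [hv])]

theorem IsPartialBranching.insert_root (h : IsPartialBranching D k S A F) {v : V} (hv : v ∉ S)
    (hdeg : (arcsInto A v).card ≤ k) (htight : ∀ Y, v ∈ Y → ¬ IsTight k S A Y) :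
    IsPartialBranching D k (insert v S) A F where
  subset := h.subset
  adj_of_notMem := h.adj_of_notMem
  mem_or_mem := h.mem_or_mem
  isAcyclic := h.isAcyclic
  mem_of_adj u w huw := Finset.mem_insert_of_mem (h.mem_of_adj u w huw)
  card_arcsInto_le := h.card_arcsInto_le
  card_arcsInto_le_of_mem w hw := by
    obtain rfl | hw := Finset.mem_insert.1 hw
    · exact hdeg
    · exact h.card_arcsInto_le_of_mem w hw
  sparse X hX := by
    have hs := h.sparse X hX
    by_cases hvX : v ∈ X
    · have := htight X hvX
      unfold IsTight at this
      rw [card_inter_insert_of_mem hv hvX]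
      omega
    · rwa [Finset.inter_insert_of_notMem hvX]

theorem IsPartialBranching.insert_arc (h : IsPartialBranching D k S A F) {u v : V} (hu : u ∈ S)
    (hv : v ∉ S) (ha : (u, v) ∈ A) (htight : ∀ Y, v ∈ Y → u ∉ Y → ¬ IsTight k S A Y) :
    IsPartialBranching D k (insert v S) (A.erase (u, v)) (F ⊔ edge u v) := by
  have huv : u ≠ v := fun e => hv (e ▸ hu)
  have hinto : ∀ w, (arcsInto (A.erase (u, v)) w).card ≤ (arcsInto A w).card := fun w =>
    Finset.card_le_card (Finset.filter_subset_filter _ (Finset.erase_subset _ _))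
  have hnotreach : ¬ F.Reachable u v :=
    not_reachable_of_neighborSet_right_eq_empty huv
      (Set.eq_empty_of_forall_notMem fun w hw => hv (h.mem_of_adj v w hw))
  refine
    { subset := (Finset.erase_subset _ _).trans h.subset
      adj_of_notMem := ?_
      mem_or_mem := ?_
      isAcyclic := h.isAcyclic.sup_edge_of_not_reachable hnotreach
      mem_of_adj := ?_
      card_arcsInto_le := fun w => (hinto w).trans (h.card_arcsInto_le w)
      card_arcsInto_le_of_mem := ?_
      sparse := ?_ }
  · intro a haD haA
    by_cases hau : a = (u, v)
    · subst hau
      simp [edge_adj, huv]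
    · exact Or.inl (h.adj_of_notMem a haD fun hA => haA (Finset.mem_erase.2 ⟨hau, hA⟩))
  · rintro x y (hxy | hxy)
    · exact h.mem_or_mem x y hxy
    · rw [edge_adj] at hxy
      have := h.subset ha
      rcases hxy.1 with ⟨rfl, rfl⟩ | ⟨rfl, rfl⟩ <;> tauto
  · rintro x y (hxy | hxy)
    · exact Finset.mem_insert_of_mem (h.mem_of_adj x y hxy)
    · rw [edge_adj] at hxy
      rcases hxy.1 with ⟨rfl, rfl⟩ | ⟨rfl, rfl⟩ <;> simp [hu]
  · intro w hw
    obtain rfl | hw := Finset.mem_insert.1 hw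
    · have := card_arcsInto_erase_add_one ha
      have := h.card_arcsInto_le w
      omega
    · exact (hinto w).trans (h.card_arcsInto_le_of_mem w hw)
  · intro X hX
    have hs := h.sparse X hX
    have hle := Finset.card_le_card (inducedArcs_mono (A.erase_subset (u, v)) X)
    by_cases hvX : v ∈ X
    · rw [card_inter_insert_of_mem hv hvX]
      by_cases huX : u ∈ X
      · have := card_inducedArcs_erase_add_one ha huX hvX
        omega
      · have := htight X hvX huX
        unfold IsTight at this
        omega
    · rw [Finset.inter_insert_of_notMem hvX]
      omega

/-- Tight sets that meet are closed under intersection. -/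
theorem IsPartialBranching.isTight_inter (h : IsPartialBranching D k S A F) {X Y : Finset V}
    (hX : IsTight k S A X) (hY : IsTight k S A Y) (hXY : (X ∩ Y).Nonempty) :
    IsTight k S A (X ∩ Y) := by
  have hsuper := card_inducedArcs_add_card_inducedArcs_le A X Y
  have hinter := h.sparse _ hXY
  have hunion := h.sparse (X ∪ Y)
    (hXY.mono (Finset.inter_subset_left.trans Finset.subset_union_left))
  have hcard := congrArg ((k + 1) * ·) (Finset.card_union_add_card_inter X Y)
  have hcardS := Finset.card_union_add_card_inter (X ∩ S) (Y ∩ S)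
  rw [← Finset.union_inter_distrib_right, ← Finset.inter_inter_distrib_right] at hcardS
  simp only [mul_add] at hcard
  unfold IsTight at *
  omega

/-- A tight set not contained in `S` has an arc from its part inside `S` to its part
outside `S`. -/
theorem IsPartialBranching.exists_arc_of_isTight (h : IsPartialBranching D k S A F)
    (hD : ∀ X : Finset V, X.Nonempty → (inducedArcs D X).card + (k + 1) ≤ (k + 1) * X.card)
    {X : Finset V} (hX : IsTight k S A X) (hXS : ¬ X ⊆ S) :
    ∃ u v, u ∈ X ∧ u ∈ S ∧ v ∈ X ∧ v ∉ S ∧ (u, v) ∈ A := by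
  by_contra! hno
  have hW := hD (X \ S) (Finset.sdiff_nonempty.2 hXS)
  have hmono := Finset.card_le_card (inducedArcs_mono h.subset (X \ S))
  have hT : (A.filter fun a => a.2 ∈ X ∩ S).card ≤ k * (X ∩ S).card :=
    card_filter_head_mem_le fun v hv => h.card_arcsInto_le_of_mem v (Finset.mem_inter.1 hv).2
  have hsub : inducedArcs A X ⊆ (A.filter fun a => a.2 ∈ X ∩ S) ∪ inducedArcs A (X \ S) := by
    intro a ha
    have := hno a.1 a.2
    simp only [inducedArcs, Finset.mem_union, Finset.mem_filter, Finset.mem_inter,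
      Finset.mem_sdiff] at ha ⊢
    tauto
  have hle := (Finset.card_le_card hsub).trans (Finset.card_union_le _ _)
  have hcard := Finset.card_inter_add_card_sdiff X S
  unfold IsTight at hX
  rw [← hcard] at hX
  simp only [mul_add, add_mul] at *
  omega

theorem IsPartialBranching.exists_insert [Fintype V] (h : IsPartialBranching D k S A F)
    (hD : ∀ X : Finset V, X.Nonempty → (inducedArcs D X).card + (k + 1) ≤ (k + 1) * X.card)
    (hS : S ≠ Finset.univ) :
    ∃ v ∉ S, ∃ A' F', IsPartialBranching D k (insert v S) A' F' := by
  by_cases htight : ∃ X, IsTight k S A X ∧ ¬ X ⊆ S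
  · obtain ⟨X, ⟨hX, hXS⟩, hmin⟩ :=
      exists_minimal_of_wellFoundedLT (fun X => IsTight k S A X ∧ ¬ X ⊆ S) htight
    obtain ⟨u, v, huX, huS, hvX, hvS, ha⟩ := h.exists_arc_of_isTight hD hX hXS
    refine ⟨v, hvS, _, _, h.insert_arc huS hvS ha fun Y hvY huY hY => huY ?_⟩
    have hv : v ∈ X ∩ Y := Finset.mem_inter.2 ⟨hvX, hvY⟩
    have hle := hmin ⟨h.isTight_inter hX hY ⟨v, hv⟩, fun hsub => hvS (hsub hv)⟩
      Finset.inter_subset_left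
    exact (Finset.mem_inter.1 (hle huX)).2
  · push Not at htight
    by_cases harc : ∃ u v, u ∈ S ∧ v ∉ S ∧ (u, v) ∈ A
    · obtain ⟨u, v, huS, hvS, ha⟩ := harc
      exact ⟨v, hvS, _, _, h.insert_arc huS hvS ha fun Y hvY _ hY => hvS (htight Y hY hvY)⟩
    push Not at harc
    obtain ⟨v, hvS, hdeg⟩ : ∃ v ∉ S, (arcsInto A v).card ≤ k := by
      by_contra! hdeg
      have hlow : (k + 1) * Sᶜ.card ≤ (A.filter fun a => a.2 ∈ Sᶜ).card :=
        le_card_filter_head_mem fun v hv => hdeg v (Finset.mem_compl.1 hv)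
      have hsub : (A.filter fun a => a.2 ∈ Sᶜ) ⊆ inducedArcs D Sᶜ := by
        intro a ha
        obtain ⟨haA, ha⟩ := Finset.mem_filter.1 ha
        refine Finset.mem_filter.2 ⟨h.subset haA, Finset.mem_compl.2 fun hu => ?_, ha⟩
        exact harc a.1 a.2 hu (Finset.mem_compl.1 ha) haA
      have hne : Sᶜ.Nonempty :=
        Finset.nonempty_iff_ne_empty.2 fun he => hS (Finset.compl_eq_empty_iff S |>.1 he)
      have := hD _ hne
      have := Finset.card_le_card hsub
      omega
    exact ⟨v, hvS, _, _, h.insert_root hvS hdeg fun Y hvY hY => hvS (htight Y hY hvY)⟩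

theorem IsPartialBranching.exists_univ {S : Finset V} {A : Finset (V × V)} {F : SimpleGraph V}
    [Fintype V]
    (hD : ∀ X : Finset V, X.Nonempty → (inducedArcs D X).card + (k + 1) ≤ (k + 1) * X.card)
    (h : IsPartialBranching D k S A F) :
    ∃ A' F', IsPartialBranching D k Finset.univ A' F' := by
  by_cases hS : S = Finset.univ
  · exact ⟨A, F, hS ▸ h⟩
  · obtain ⟨v, hv, A', F', h'⟩ := h.exists_insert hD hS
    exact exists_univ hD h'
termination_by Sᶜ.card
decreasing_by exact Finset.card_lt_card (Finset.compl_ssubset_compl.2 (Finset.ssubset_insert hv))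

/-- A digraph with in-degrees at most `k` in which every nonempty vertex set `X` induces at
most `k (|X| - 1)` arcs can be covered by `k` forests. -/
theorem exists_forest_cover_of_sparse [Fintype V] (k : ℕ) (D : Finset (V × V))
    (hdeg : ∀ v, (arcsInto D v).card ≤ k)
    (hD : ∀ X : Finset V, X.Nonempty → (inducedArcs D X).card + k ≤ k * X.card) :
    ∃ F : Fin k → SimpleGraph V, (∀ i, (F i).IsAcyclic) ∧
      (∀ i u v, (F i).Adj u v → (u, v) ∈ D ∨ (v, u) ∈ D) ∧
      ∀ a ∈ D, ∃ i, (F i).Adj a.1 a.2 := by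
  induction k generalizing D with
  | zero =>
    refine ⟨fun i => i.elim0, fun i => i.elim0, fun i => i.elim0, fun a ha => ?_⟩
    have := hdeg a.2
    rw [Nat.le_zero, Finset.card_eq_zero] at this
    exact absurd (this ▸ Finset.mem_filter.2 ⟨ha, rfl⟩) (Finset.notMem_empty a)
  | succ k ih =>
    have hinit : IsPartialBranching D k ∅ D ⊥ :=
      { subset := Finset.Subset.refl D
        adj_of_notMem := fun a ha ha' => absurd ha ha'
        mem_or_mem := fun _ _ h => h.elim
        isAcyclic := isAcyclic_bot
        mem_of_adj := fun _ _ h => h.elim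
        card_arcsInto_le := hdeg
        card_arcsInto_le_of_mem := fun v hv => absurd hv (Finset.notMem_empty v)
        sparse := fun X hX => by
          have := hD X hX
          rw [Finset.inter_empty, Finset.card_empty]
          omega }
    obtain ⟨A, F, h⟩ := hinit.exists_univ hD
    obtain ⟨F', hacyc, hle, hcover⟩ := ih A
      (fun v => h.card_arcsInto_le_of_mem v (Finset.mem_univ v))
      (fun X hX => by
        have := h.sparse X hX
        rw [Finset.inter_univ, add_mul] at this
        omega)
    refine ⟨Fin.cons F F', Fin.cases h.isAcyclic hacyc, Fin.cases h.mem_or_mem fun i u v huv =>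
      (hle i u v huv).imp (h.subset ·) (h.subset ·), fun a ha => ?_⟩
    by_cases haA : a ∈ A
    · obtain ⟨i, hi⟩ := hcover a haA
      exact ⟨i.succ, hi⟩
    · exact ⟨0, h.adj_of_notMem a ha haA⟩

/-- A loopless simple digraph with in-degrees at most `d` satisfies the sparsity condition for
being covered by `d + 1` forests. -/
theorem card_inducedArcs_add_le_of_card_arcsInto_le {d : ℕ} (hloop : ∀ v, (v, v) ∉ D)
    (hdeg : ∀ v, (arcsInto D v).card ≤ d) {X : Finset V} (hX : X.Nonempty) :
    (inducedArcs D X).card + (d + 1) ≤ (d + 1) * X.card := by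
  have hle : (inducedArcs D X).card ≤ d * X.card :=
    (Finset.card_le_card fun a ha => by
      simp only [inducedArcs, Finset.mem_filter] at ha ⊢
      exact ⟨ha.1, ha.2.2⟩).trans (card_filter_head_mem_le (T := X) fun v _ => hdeg v)
  have hoff : inducedArcs D X ⊆ X.offDiag := fun a ha => by
    simp only [inducedArcs, Finset.mem_filter, Finset.mem_offDiag] at ha ⊢
    refine ⟨ha.2.1, ha.2.2, fun he => hloop a.1 ?_⟩
    have : a = (a.1, a.1) := Prod.ext rfl he.symm
    exact this ▸ ha.1
  have hoff := Finset.card_le_card hoff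
  rw [Finset.offDiag_card] at hoff
  obtain ⟨n, hn⟩ : ∃ n, X.card = n + 1 := Nat.exists_eq_succ_of_ne_zero hX.card_ne_zero
  rw [hn] at hle hoff ⊢
  rcases le_or_gt d n with hdn | hdn
  · nlinarith
  · have : (n + 1) * (n + 1) - (n + 1) = (n + 1) * n := by
      rw [mul_add, mul_one, Nat.add_sub_cancel]
    have := Nat.mul_le_mul_right n (show n + 1 ≤ d + 1 by omega)
    nlinarith

end Branching

/-- If every edge of a graph `G` can be oriented so that every vertex has
in-degree at most `d`, then the arboricity of `G` is at most `d + 1`. -/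
theorem stmt9 (V : Type) [Fintype V] (G : SimpleGraph V) (D : V → V → Prop) (d : ℕ)
    (horient : ∀ u v : V, D u v → G.Adj u v)
    (hcover : ∀ u v : V, G.Adj u v → D u v ∨ D v u)
    (hone : ∀ u v : V, ¬(D u v ∧ D v u))
    (hindeg : ∀ w : V, {u : V | D u w}.ncard ≤ d) :
    ArboricityLE G (d + 1) := by
  classical
  let A : Finset (V × V) := {a | D a.1 a.2}
  have hA : ∀ u v, (u, v) ∈ A ↔ D u v := fun u v => by simp [A]
  have hloop : ∀ v, (v, v) ∉ A := fun v hv => (horient v v ((hA v v).1 hv)).ne rfl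
  have hdeg : ∀ w, (arcsInto A w).card ≤ d := fun w => by
    refine le_trans ?_ (hindeg w)
    rw [← Set.ncard_coe_finset]
    refine Set.ncard_le_ncard_of_injOn Prod.fst ?_ ?_
    · rintro ⟨u, v⟩ h
      obtain ⟨huv, rfl⟩ := Finset.mem_filter.1 h
      exact (hA _ _).1 huv
    · rintro ⟨u, v⟩ h ⟨u', v'⟩ h' he
      exact Prod.ext he ((Finset.mem_filter.1 h).2.trans (Finset.mem_filter.1 h').2.symm)
  obtain ⟨F, hacyc, hle, hcov⟩ := exists_forest_cover_of_sparse (d + 1) A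
    (fun w => (hdeg w).trans d.le_succ)
    (fun X hX => card_inducedArcs_add_le_of_card_arcsInto_le hloop hdeg hX)
  refine ⟨F, fun i u v huv => ?_, hacyc, fun u v huv => ?_⟩
  · rcases hle i u v huv with h | h
    · exact horient u v ((hA u v).1 h)
    · exact (horient v u ((hA v u).1 h)).symm
  · rcases hcover u v huv with h | h
    · exact hcov (u, v) ((hA u v).2 h)
    · obtain ⟨i, hi⟩ := hcov (v, u) ((hA v u).2 h)
      exact ⟨i, hi.symm⟩
end

section
/- There is an absolute constant c such that the following holds for every integer n ≥ 2. Let L be a set of n points on the real line and let S be a set of Steiner points placed so that between every two consecutive points of L there are n points of S. Then there exists a graph H on a subset of L ∪ S containing L, with each edge {u,v} weighted |u−v|, together with an orientation of its edges of maximum in-degree at most c, such that every pair of points of L is joined by a path in H with at most 2 edges whose total weight equals their distance. -/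
open SimpleGraph

/-- Distinct pairs of points of `L` can be given distinct points of `S`, the one given to `(a, b)`
lying between `a` and the successor of `a` in `L`. -/
lemma exists_private_point {n : ℕ} {L S : Finset ℝ} (hL : L.card = n)
    (hS : ∀ a ∈ L, ∀ b ∈ L, a < b → (∀ x ∈ L, ¬(a < x ∧ x < b)) →
      n ≤ ((S : Set ℝ) ∩ Set.Ioo a b).ncard) :
    ∃ f : ℝ → ℝ → ℝ,
      (∀ a ∈ L, ∀ b ∈ L, a < b →
        f a b ∈ S ∧ a < f a b ∧ f a b < b ∧ ∀ x ∈ L, ¬(a < x ∧ x ≤ f a b)) ∧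
      (∀ a ∈ L, ∀ b ∈ L, ∀ a' ∈ L, ∀ b' ∈ L, a < b → a' < b' → f a b = f a' b' →
        a = a' ∧ b = b') := by
  have key : ∀ a : ℝ, ∃ g : ℝ → ℝ, a ∈ L → (∀ b ∈ L, a < b →
      g b ∈ S ∧ a < g b ∧ g b < b ∧ ∀ x ∈ L, ¬(a < x ∧ x ≤ g b)) ∧ Set.InjOn g L := by
    intro a
    by_cases h : a ∈ L ∧ (L.filter (a < ·)).Nonempty
    · obtain ⟨ha, hne⟩ := h
      obtain ⟨c, hc, hmin⟩ := (L.filter (a < ·)).exists_min_image id hne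
      simp only [Finset.mem_filter, id, and_imp] at hc hmin
      have hcard := hS a ha c hc.1 hc.2 fun x hx hxc => (hmin x hx hxc.1).not_gt hxc.2
      have hfin : ((S : Set ℝ) ∩ Set.Ioo a c).Finite := S.finite_toSet.inter_of_left _
      obtain ⟨g, hg, hinj⟩ := (L.finite_toSet).exists_injOn_of_encard_le
        (t := (S : Set ℝ) ∩ Set.Ioo a c) (by
          rw [Set.encard_coe_eq_coe_finsetCard, hL, ← hfin.cast_ncard_eq]
          exact_mod_cast hcard)
      refine ⟨g, fun _ => ⟨fun b hb hab => ?_, hinj⟩⟩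
      obtain ⟨h1, h2, h3⟩ := hg hb
      exact ⟨h1, h2, h3.trans_le (hmin b hb hab), fun x hx hxg =>
        ((hmin x hx hxg.1).trans hxg.2).not_gt h3⟩
    · refine ⟨id, fun ha => ⟨fun b hb hab => (h ⟨ha, b, ?_⟩).elim, Set.injOn_id _⟩⟩
      simp [hb, hab]
  choose f hf using key
  refine ⟨f, fun a ha => (hf a ha).1, fun a ha b hb a' ha' b' hb' hab hab' heq => ?_⟩
  obtain ⟨-, h1, -, h2⟩ := (hf a ha).1 b hb hab
  obtain ⟨-, h1', -, h2'⟩ := (hf a' ha').1 b' hb' hab'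
  rcases lt_trichotomy a a' with h | rfl | h
  · exact (h2 a' ha' ⟨h, heq ▸ h1'.le⟩).elim
  · exact ⟨rfl, (hf a ha).2 hb hb' heq⟩
  · exact (h2' a ha ⟨h, heq ▸ h1.le⟩).elim

/-- There is an absolute constant `c` such that for every `n ≥ 2`, any
set `L` of `n` points on the line with a set `S` of Steiner points having `n` points of `S`
between every two consecutive points of `L` admits a Steiner 1-spanner with hop-diameter
`2` whose edges can be oriented with maximum in-degree at most `c`. -/
theorem stmt10 :
    ∃ c : ℕ,
      ∀ n : ℕ, 2 ≤ n → ∀ L S : Finset ℝ, L.card = n →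
        (∀ a ∈ L, ∀ b ∈ L, a < b → (∀ x ∈ L, ¬(a < x ∧ x < b)) →
          n ≤ ((S : Set ℝ) ∩ Set.Ioo a b).ncard) →
        ∃ (H : SimpleGraph {x : ℝ // x ∈ L ∨ x ∈ S})
          (D : {x : ℝ // x ∈ L ∨ x ∈ S} → {x : ℝ // x ∈ L ∨ x ∈ S} → Prop),
          (∀ u v, D u v → H.Adj u v) ∧
          (∀ u v, H.Adj u v → D u v ∨ D v u) ∧
          (∀ u v, ¬(D u v ∧ D v u)) ∧
          (∀ w, {u | D u w}.ncard ≤ c) ∧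
          (∀ a ∈ L, ∀ b ∈ L,
            ∃ (m : ℕ) (x : Fin (m + 1) → {x : ℝ // x ∈ L ∨ x ∈ S}),
              m ≤ 2 ∧ (x 0).1 = a ∧ (x (Fin.last m)).1 = b ∧
              (∀ i : Fin m, H.Adj (x i.castSucc) (x i.succ)) ∧
              (∑ i : Fin m, |(x i.castSucc).1 - (x i.succ).1|) = |a - b|) := by
  refine ⟨2, fun n _ L S hL hS => ?_⟩
  obtain ⟨f, hf, hinj⟩ := exists_private_point hL hS
  let D : {x : ℝ // x ∈ L ∨ x ∈ S} → {x : ℝ // x ∈ L ∨ x ∈ S} → Prop := fun u v =>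
    ∃ a ∈ L, ∃ b ∈ L, a < b ∧ v.1 = f a b ∧ (u.1 = a ∨ u.1 = b)
  have source_mem : ∀ u v, D u v → u.1 ∈ L := by
    rintro u v ⟨a, ha, b, hb, -, -, h | h⟩ <;> rwa [h]
  have target_notMem : ∀ u v, D u v → v.1 ∉ L := by
    rintro u v ⟨a, ha, b, hb, hab, h, -⟩ hv
    rw [h] at hv
    obtain ⟨-, h1, -, h2⟩ := hf a ha b hb hab
    exact h2 _ hv ⟨h1, le_rfl⟩
  let H : SimpleGraph {x : ℝ // x ∈ L ∨ x ∈ S} :=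
    { Adj := fun u v => D u v ∨ D v u
      symm := ⟨fun _ _ h => h.symm⟩
      loopless := ⟨fun u h => h.elim (fun h => target_notMem u u h (source_mem u u h))
        (fun h => target_notMem u u h (source_mem u u h))⟩ }
  refine ⟨H, D, fun _ _ => Or.inl, fun _ _ h => h,
    fun u v h => target_notMem v u h.2 (source_mem u v h.1), fun w => ?_, fun a ha b hb => ?_⟩
  · rcases Set.eq_empty_or_nonempty {u | D u w} with h | ⟨u, a, ha, b, hb, hab, hw, -⟩
    · simp [h]
    · refine (Set.ncard_le_ncard (t := {⟨a, Or.inl ha⟩, ⟨b, Or.inl hb⟩}) ?_).trans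
        ((Set.ncard_insert_le _ _).trans (by simp))
      rintro v ⟨a', ha', b', hb', hab', hw', hv⟩
      obtain ⟨rfl, rfl⟩ := hinj a ha b hb a' ha' b' hb' hab hab' (hw.symm.trans hw')
      simpa [Subtype.ext_iff] using hv
  · rcases lt_trichotomy a b with h | rfl | h
    · obtain ⟨hs, h1, h2, -⟩ := hf a ha b hb h
      refine ⟨2, ![⟨a, Or.inl ha⟩, ⟨f a b, Or.inr hs⟩, ⟨b, Or.inl hb⟩], le_rfl, rfl, rfl, ?_, ?_⟩
      · intro i
        fin_cases i
        · exact Or.inl ⟨a, ha, b, hb, h, rfl, Or.inl rfl⟩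
        · exact Or.inr ⟨a, ha, b, hb, h, rfl, Or.inr rfl⟩
      · rw [Fin.sum_univ_two]
        change |a - f a b| + |f a b - b| = |a - b|
        rw [abs_of_neg (sub_neg.2 h1), abs_of_neg (sub_neg.2 h2), abs_of_neg (sub_neg.2 h)]
        ring
    · exact ⟨0, fun _ => ⟨a, Or.inl ha⟩, by simp, rfl, rfl, fun i => i.elim0, by simp⟩
    · obtain ⟨hs, h1, h2, -⟩ := hf b hb a ha h
      refine ⟨2, ![⟨a, Or.inl ha⟩, ⟨f b a, Or.inr hs⟩, ⟨b, Or.inl hb⟩], le_rfl, rfl, rfl, ?_, ?_⟩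
      · intro i
        fin_cases i
        · exact Or.inl ⟨b, hb, a, ha, h, rfl, Or.inr rfl⟩
        · exact Or.inr ⟨b, hb, a, ha, h, rfl, Or.inl rfl⟩
      · rw [Fin.sum_univ_two]
        change |a - f b a| + |f b a - b| = |a - b|
        rw [abs_of_pos (sub_pos.2 h1), abs_of_pos (sub_pos.2 h2), abs_of_pos (sub_pos.2 h)]
        ring
end

section
/- There is an absolute constant c such that the following holds for all integers n ≥ 2 and k ≥ 2. Let L be a set of n points on the real line and let S be a set of Steiner points placed so that between every two consecutive points of L there are α_k(n) points of S. Then there exists a graph H on a subset of L ∪ S containing L, with each edge {u,v} weighted |u−v|, together with an orientation of its edges of maximum in-degree at most c, such that every pair of points of L is joined by a path in H with at most 2k edges whose total weight equals their distance. -/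
open SimpleGraph

/-- Monotone reachability by at most `h` links of the relation `R`. -/
inductive HopReach (R : ℕ → ℕ → Prop) : ℕ → ℕ → ℕ → Prop
  | refl (h i : ℕ) : HopReach R h i i
  | step {h i k j : ℕ} : R i k → HopReach R h k j → HopReach R (h + 1) i j

theorem HopReach.mono {R : ℕ → ℕ → Prop} {h i j : ℕ} (H : HopReach R h i j) :
    ∀ {h' : ℕ}, h ≤ h' → HopReach R h' i j := by
  induction H with
  | refl h i => intro h' _; exact .refl _ _
  | step hr _ ih =>
    intro h' hh
    obtain ⟨h'', rfl⟩ : ∃ h'', h' = h'' + 1 := ⟨h' - 1, by omega⟩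
    exact .step hr (ih (by omega))

theorem HopReach.trans {R : ℕ → ℕ → Prop} {h h' i j k : ℕ} (H : HopReach R h i j)
    (H' : HopReach R h' j k) : HopReach R (h + h') i k := by
  induction H with
  | refl h i => exact H'.mono (by omega)
  | step hr _ ih =>
    have := HopReach.step hr (ih H')
    exact this.mono (by omega)

theorem HopReach.single {R : ℕ → ℕ → Prop} {i j : ℕ} (H : R i j) : HopReach R 1 i j :=
  .step H (.refl 0 j)

theorem HopReach.le {R : ℕ → ℕ → Prop} (hR : ∀ i k, R i k → i < k) {h i j : ℕ}
    (H : HopReach R h i j) : i ≤ j := by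
  induction H with
  | refl => exact le_rfl
  | step hr _ ih => exact (hR _ _ hr).le.trans ih

theorem HopReach.map {R R' : ℕ → ℕ → Prop} (hR : ∀ i k, R i k → i < k) (f : ℕ → ℕ) {b : ℕ}
    (hf : ∀ i k, R i k → k ≤ b → R' (f i) (f k)) {h i j : ℕ}
    (H : HopReach R h i j) (hj : j ≤ b) : HopReach R' h (f i) (f j) := by
  induction H with
  | refl => exact .refl _ _
  | step hr H ih => exact .step (hf _ _ hr ((H.le hR).trans hj)) (ih hj)

/-- The links stored in the slots `E g l`, `l < s`, of the gaps `g = (g, g + 1)`;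
a link may only be stored in a gap that it spans. -/
def SlotLink (E : ℕ → ℕ → ℕ × ℕ) (s i j : ℕ) : Prop :=
  ∃ g l, l < s ∧ E g l = (i, j) ∧ i ≤ g ∧ g < j

theorem SlotLink.lt {E : ℕ → ℕ → ℕ × ℕ} {s : ℕ} (i j : ℕ) (H : SlotLink E s i j) : i < j := by
  obtain ⟨g, l, -, -, h1, h2⟩ := H
  omega

/-- The points `0, …, n - 1` have a monotone spanner with hop-diameter `h` whose links can be
stored in the gaps they span, with at most `s` links per gap. -/
def HasLoadSpanner (h n s : ℕ) : Prop :=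
  ∃ E : ℕ → ℕ → ℕ × ℕ, ∀ i j, i ≤ j → j < n → HopReach (SlotLink E s) h i j

theorem HasLoadSpanner.mono {h h' n n' s s' : ℕ} (H : HasLoadSpanner h n s) (hh : h ≤ h')
    (hn : n' ≤ n) (hs : s ≤ s') : HasLoadSpanner h' n' s' := by
  obtain ⟨E, hE⟩ := H
  refine ⟨E, fun i j hij hj => ?_⟩
  refine ((hE i j hij (by omega)).map SlotLink.lt id (b := j) ?_ le_rfl).mono hh
  rintro i k ⟨g, l, hl, h⟩ -
  exact ⟨g, l, by omega, h⟩

theorem hasLoadSpanner_one (h : ℕ) : HasLoadSpanner h 1 0 :=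
  ⟨fun _ _ => (0, 0), fun i j hij hj => by
    obtain rfl : i = j := by omega
    exact .refl _ _⟩

theorem hasLoadSpanner_complete (s : ℕ) : HasLoadSpanner 1 (s + 1) s := by
  refine ⟨fun g l => (g, g + 1 + l), fun i j hij hj => ?_⟩
  rcases hij.eq_or_lt with rfl | hij
  · exact .refl _ _
  · refine .single ⟨i, j - i - 1, by omega, ?_, le_rfl, hij⟩
    simp only [Prod.mk.injEq, true_and]
    omega

theorem mul_add_div_mod {q r t : ℕ} (hr : r < t + 1) :
    (q * (t + 1) + r) / (t + 1) = q ∧ (q * (t + 1) + r) % (t + 1) = r := by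
  constructor
  · rw [mul_comm, Nat.mul_add_div (by omega), Nat.div_eq_of_lt hr, add_zero]
  · rw [mul_comm, Nat.mul_add_mod, Nat.mod_eq_of_lt hr]

/-- Split the points into `m + 1` blocks of `t` points separated by `m` cut points, join every
point to the two neighbouring cut points, and treat blocks and cut points recursively. -/
theorem HasLoadSpanner.step {h t s m N : ℕ} (H : HasLoadSpanner (h + 2) t s)
    (H' : HasLoadSpanner h m t) (hN : N + 1 ≤ (m + 1) * (t + 1)) :
    HasLoadSpanner (h + 2) N (s + 3) := by
  obtain ⟨E, hE⟩ := H
  obtain ⟨F, hF⟩ := H'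
  let E' : ℕ → ℕ → ℕ × ℕ := fun g l =>
    if l < s then (g / (t + 1) * (t + 1) + (E (g % (t + 1)) l).1,
      g / (t + 1) * (t + 1) + (E (g % (t + 1)) l).2)
    else if l = s then (g, g / (t + 1) * (t + 1) + t)
    else if l = s + 1 then ((g + 1) / (t + 1) * (t + 1) - 1, g + 1)
    else ((F ((g + 1) / (t + 1) - 1) ((g + 1) % (t + 1))).1 * (t + 1) + t,
      (F ((g + 1) / (t + 1) - 1) ((g + 1) % (t + 1))).2 * (t + 1) + t)
  have block : ∀ q i j, i ≤ j → j < t →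
      HopReach (SlotLink E' (s + 3)) (h + 2) (q * (t + 1) + i) (q * (t + 1) + j) := by
    intro q i j hij hj
    refine (hE i j hij hj).map SlotLink.lt (fun x => q * (t + 1) + x) (b := t) ?_ hj.le
    rintro i k ⟨g, l, hl, he, h1, h2⟩ hk
    obtain ⟨e1, e2⟩ := mul_add_div_mod (q := q) (r := g) (t := t) (by omega)
    refine ⟨q * (t + 1) + g, l, by omega, ?_, by omega, by omega⟩
    simp only [E', if_pos hl, e1, e2, he]
  have right : ∀ q r, r ≤ t →
      HopReach (SlotLink E' (s + 3)) 1 (q * (t + 1) + r) (q * (t + 1) + t) := by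
    intro q r hr
    rcases hr.eq_or_lt with rfl | hr
    · exact .refl _ _
    obtain ⟨e1, e2⟩ := mul_add_div_mod (q := q) (r := r) (t := t) (by omega)
    refine .single ⟨q * (t + 1) + r, s, by omega, ?_, le_rfl, by omega⟩
    simp [E', e1]
  have left : ∀ q r, r ≤ t →
      HopReach (SlotLink E' (s + 3)) 1 (q * (t + 1) + t) ((q + 1) * (t + 1) + r) := by
    intro q r hr
    obtain ⟨e1, e2⟩ := mul_add_div_mod (q := q + 1) (r := r) (t := t) (by omega)
    have e3 : (q + 1) * (t + 1) = q * (t + 1) + t + 1 := by ring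
    have e4 : (q + 1) * (t + 1) + r - 1 + 1 = (q + 1) * (t + 1) + r := by omega
    refine .single ⟨(q + 1) * (t + 1) + r - 1, s + 1, by omega, ?_, by omega, by omega⟩
    simp only [E', e4, e1]
    simp [e3]
  have cuts : ∀ i j, i ≤ j → j < m →
      HopReach (SlotLink E' (s + 3)) h (i * (t + 1) + t) (j * (t + 1) + t) := by
    intro i j hij hj
    refine (hF i j hij hj).map SlotLink.lt (fun x => x * (t + 1) + t) (b := j) ?_ le_rfl
    rintro i k ⟨g, l, hl, he, h1, h2⟩ -
    obtain ⟨e1, e2⟩ := mul_add_div_mod (q := g + 1) (r := l) (t := t) (by omega)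
    have e3 : (g + 1) * (t + 1) = g * (t + 1) + t + 1 := by ring
    have e4 : g * (t + 1) + t + l + 1 = (g + 1) * (t + 1) + l := by omega
    have e5 : i * (t + 1) ≤ g * (t + 1) := Nat.mul_le_mul_right _ h1
    have e6 : (g + 1) * (t + 1) ≤ k * (t + 1) := Nat.mul_le_mul_right _ h2
    refine ⟨g * (t + 1) + t + l, s + 2, by omega, ?_, by omega, by omega⟩
    simp only [E', e4, e1, e2, Nat.add_sub_cancel, he]
    simp
  refine ⟨E', fun i j hij hj => ?_⟩
  obtain ⟨q, r, hr, rfl⟩ : ∃ q r, r ≤ t ∧ i = q * (t + 1) + r :=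
    ⟨i / (t + 1), i % (t + 1), Nat.lt_succ_iff.1 (Nat.mod_lt _ (by omega)),
      by rw [mul_comm, Nat.div_add_mod]⟩
  obtain ⟨q', r', hr', rfl⟩ : ∃ q r, r ≤ t ∧ j = q * (t + 1) + r :=
    ⟨j / (t + 1), j % (t + 1), Nat.lt_succ_iff.1 (Nat.mod_lt _ (by omega)),
      by rw [mul_comm, Nat.div_add_mod]⟩
  have hq' : q' < m + 1 := by
    refine lt_of_mul_lt_mul_right (a := t + 1) ?_ (Nat.zero_le _)
    omega
  rcases lt_trichotomy q q' with hq | rfl | hq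
  · obtain ⟨p, rfl⟩ : ∃ p, q' = p + 1 := ⟨q' - 1, by omega⟩
    exact (((right q r hr).trans (cuts q p (by omega) (by omega))).trans
      (left p r' hr')).mono (by omega)
  · rcases hr'.eq_or_lt with rfl | hr'
    · exact (right _ r hr).mono (by omega)
    · exact block _ _ _ (by omega) hr'
  · have : (q' + 1) * (t + 1) ≤ q * (t + 1) := Nat.mul_le_mul_right _ hq
    have e3 : (q' + 1) * (t + 1) = q' * (t + 1) + t + 1 := by ring
    omega

theorem hasLoadSpanner_two_pow (h r : ℕ) : HasLoadSpanner (h + 2) (2 ^ (r + 1) - 1) (3 * r) := by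
  induction r with
  | zero => exact hasLoadSpanner_one _
  | succ r ih =>
    refine ih.step (m := 1) ((hasLoadSpanner_one h).mono le_rfl le_rfl (Nat.zero_le _)) ?_
    have : 0 < 2 ^ (r + 1) := by positivity
    rw [pow_succ 2 (r + 1)]
    omega

theorem hasLoadSpanner_two_pow_two_pow (r : ℕ) :
    HasLoadSpanner 3 (2 ^ 2 ^ r - 1) (3 * r) := by
  induction r with
  | zero => exact hasLoadSpanner_one _
  | succ r ih =>
    refine ih.step (hasLoadSpanner_complete _) ?_
    have h1 : 0 < 2 ^ 2 ^ r := by positivity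
    have h2 : 2 ^ 2 ^ (r + 1) = 2 ^ 2 ^ r * 2 ^ 2 ^ r := by
      rw [pow_succ 2 r, mul_two, pow_add]
    have h3 : 0 < 2 ^ 2 ^ (r + 1) := by positivity
    have h4 : 2 ^ 2 ^ r - 1 + 1 = 2 ^ 2 ^ r := by omega
    rw [show 2 ^ 2 ^ (r + 1) - 1 + 1 = 2 ^ 2 ^ (r + 1) by omega, h4, h2]
    exact Nat.mul_le_mul_right _ (by omega)

theorem ackA_one (s : ℕ) : ackA 1 s = 2 ^ s := by
  induction s with
  | zero => simp [ackA]
  | succ s ih => rw [ackA, ih, ackA, pow_succ, mul_comm]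

theorem ackB_one (s : ℕ) : ackB 1 s = 2 ^ 2 ^ s := by
  induction s with
  | zero => simp [ackB]
  | succ s ih => rw [ackB, ih, ackB, pow_succ 2 s, pow_mul]

theorem hasLoadSpanner_ackA (j s : ℕ) :
    HasLoadSpanner (2 * (j + 1)) (3 * ackA (j + 1) s + 9) (3 * (s + 3)) := by
  induction j generalizing s with
  | zero =>
    refine (hasLoadSpanner_two_pow 0 (s + 3)).mono le_rfl ?_ le_rfl
    have : 0 < 2 ^ s := by positivity
    rw [ackA_one, show s + 3 + 1 = s + 4 from rfl, pow_add]
    omega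
  | succ j ih =>
    induction s with
    | zero =>
      refine (hasLoadSpanner_two_pow (2 * (j + 1)) 3).mono (by omega) ?_ (by omega)
      simp [ackA]
    | succ s ihs =>
      refine HasLoadSpanner.step (h := 2 * (j + 1)) ihs (ih (ackA (j + 2) s)) ?_
      rw [show ackA (j + 1 + 1) (s + 1) = ackA (j + 1) (ackA (j + 2) s) by rw [ackA]]
      exact Nat.le_mul_of_pos_right _ (by omega)

theorem hasLoadSpanner_ackB (j s : ℕ) :
    HasLoadSpanner (2 * (j + 1) + 1) (3 * ackB (j + 1) s + 9) (3 * (s + 3)) := by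
  induction j generalizing s with
  | zero =>
    refine (hasLoadSpanner_two_pow_two_pow (s + 3)).mono le_rfl ?_ le_rfl
    rw [ackB_one, pow_add 2 s 3, pow_mul]
    have h2 : 2 ≤ 2 ^ 2 ^ s := by
      calc 2 = 2 ^ 1 := rfl
        _ ≤ 2 ^ 2 ^ s := Nat.pow_le_pow_right (by omega) Nat.one_le_two_pow
    have h3 : 2 ^ 7 ≤ (2 ^ 2 ^ s) ^ 7 := Nat.pow_le_pow_left h2 7
    have h4 : (2 ^ 2 ^ s) ^ 2 ^ 3 = (2 ^ 2 ^ s) ^ 7 * 2 ^ 2 ^ s := by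
      rw [← pow_succ]; rfl
    have h5 : 2 ^ 7 * 2 ^ 2 ^ s ≤ (2 ^ 2 ^ s) ^ 7 * 2 ^ 2 ^ s := Nat.mul_le_mul_right _ h3
    rw [h4]
    omega
  | succ j ih =>
    induction s with
    | zero =>
      refine (hasLoadSpanner_two_pow (2 * (j + 1) + 1) 3).mono (by omega) ?_ (by omega)
      simp [ackB]
    | succ s ihs =>
      refine HasLoadSpanner.step (h := 2 * (j + 1) + 1) ihs (ih (ackB (j + 2) s)) ?_
      rw [show ackB (j + 1 + 1) (s + 1) = ackB (j + 1) (ackB (j + 2) s) by rw [ackB]]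
      exact Nat.le_mul_of_pos_right _ (by omega)

theorem lt_ackA_succ (j n : ℕ) : n < ackA (j + 1) n := by
  induction j generalizing n with
  | zero => rw [ackA_one]; exact Nat.lt_two_pow_self
  | succ j ih =>
    induction n with
    | zero => simp [ackA]
    | succ n ihn => rw [ackA]; exact lt_of_le_of_lt ihn (ih _)

theorem lt_ackB_succ (j n : ℕ) : n < ackB (j + 1) n := by
  induction j generalizing n with
  | zero =>
    rw [ackB_one]
    exact Nat.lt_two_pow_self.trans Nat.lt_two_pow_self
  | succ j ih =>
    induction n with
    | zero => simp [ackB]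
    | succ n ihn => rw [ackB]; exact lt_of_le_of_lt ihn (ih _)

theorem hasLoadSpanner_invAck {n k : ℕ} (hn : 3 ≤ n) (hk : 2 ≤ k) :
    0 < invAck k n ∧ HasLoadSpanner k n (12 * invAck k n) := by
  obtain ⟨j, hj⟩ : ∃ j, k / 2 = j + 1 := ⟨k / 2 - 1, by omega⟩
  unfold invAck
  split_ifs with hp
  · rw [hj]
    have hmem := Nat.sInf_mem (s := {s : ℕ | n ≤ ackA (j + 1) s}) ⟨n, (lt_ackA_succ j n).le⟩
    set s := sInf {s : ℕ | n ≤ ackA (j + 1) s}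
    have hs : 0 < s := by
      rcases Nat.eq_zero_or_pos s with h0 | h0
      · rw [h0] at hmem
        simp [ackA] at hmem
        omega
      · exact h0
    change n ≤ ackA (j + 1) s at hmem
    exact ⟨hs, (hasLoadSpanner_ackA j s).mono (by omega) (by omega) (by omega)⟩
  · rw [hj]
    have hmem := Nat.sInf_mem (s := {s : ℕ | n ≤ ackB (j + 1) s}) ⟨n, (lt_ackB_succ j n).le⟩
    set s := sInf {s : ℕ | n ≤ ackB (j + 1) s}
    have hs : 0 < s := by
      rcases Nat.eq_zero_or_pos s with h0 | h0
      · rw [h0] at hmem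
        simp [ackB] at hmem
        omega
      · exact h0
    change n ≤ ackB (j + 1) s at hmem
    exact ⟨hs, (hasLoadSpanner_ackB j s).mono (by omega) (by omega) (by omega)⟩

/-- `u` and `v` are joined by a path in `H` with at most `m` edges whose weight, measured through
the positions `f` on the real line, equals the distance of its endpoints. -/
def HasStraightPath {V : Type} (H : SimpleGraph V) (f : V → ℝ) (m : ℕ) (u v : V) : Prop :=
  ∃ (m' : ℕ) (x : Fin (m' + 1) → V), m' ≤ m ∧ x 0 = u ∧ x (Fin.last m') = v ∧
    (∀ i : Fin m', H.Adj (x i.castSucc) (x i.succ)) ∧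
    (∑ i : Fin m', |f (x i.castSucc) - f (x i.succ)|) = |f u - f v|

theorem HasStraightPath.refl {V : Type} (H : SimpleGraph V) (f : V → ℝ) (m : ℕ) (u : V) :
    HasStraightPath H f m u u :=
  ⟨0, fun _ => u, Nat.zero_le _, rfl, rfl, fun i => i.elim0, by simp⟩

theorem HasStraightPath.cons {V : Type} {H : SimpleGraph V} {f : V → ℝ} {m : ℕ} {u w v : V}
    (huw : H.Adj u w) (h1 : f u ≤ f w) (h2 : f w ≤ f v) (hp : HasStraightPath H f m w v) :
    HasStraightPath H f (m + 1) u v := by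
  obtain ⟨m', x, hm, x0, xl, hadj, hsum⟩ := hp
  refine ⟨m' + 1, Fin.cons u x, by omega, rfl, ?_, ?_, ?_⟩
  · rw [← Fin.succ_last, Fin.cons_succ, xl]
  · intro i
    refine Fin.cases ?_ (fun i => ?_) i
    · simpa [x0] using huw
    · simpa [← Fin.succ_castSucc] using hadj i
  · rw [Fin.sum_univ_succ]
    simp only [Fin.castSucc_zero, Fin.cons_zero, Fin.cons_succ, ← Fin.succ_castSucc, hsum, x0]
    rw [abs_of_nonpos (by linarith), abs_of_nonpos (by linarith), abs_of_nonpos (by linarith)]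
    ring

theorem HasStraightPath.symm {V : Type} {H : SimpleGraph V} {f : V → ℝ} {m : ℕ} {u v : V}
    (hp : HasStraightPath H f m u v) : HasStraightPath H f m v u := by
  obtain ⟨m', x, hm, x0, xl, hadj, hsum⟩ := hp
  refine ⟨m', fun i => x i.rev, hm, by simpa using xl, by simpa using x0, ?_, ?_⟩
  · intro i
    simpa [Fin.rev_castSucc, Fin.rev_succ] using (hadj i.rev).symm
  · rw [abs_sub_comm, ← hsum, ← Equiv.sum_comp Fin.revPerm]
    refine Finset.sum_congr rfl fun i _ => ?_
    simp only [Fin.revPerm_apply, Fin.rev_castSucc, Fin.rev_succ, Fin.rev_rev]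
    exact abs_sub_comm _ _

theorem HopReach.hasStraightPath {V : Type} {H : SimpleGraph V} {f : V → ℝ} {P : ℕ → V} {n : ℕ}
    {R : ℕ → ℕ → Prop} (hR : ∀ i k, R i k → i < k)
    (hP : ∀ i j, i < j → j < n → f (P i) < f (P j))
    (hH : ∀ i k, R i k → k < n → ∃ w, H.Adj (P i) w ∧ H.Adj w (P k) ∧
      f (P i) ≤ f w ∧ f w ≤ f (P k)) {h i j : ℕ} (hr : HopReach R h i j) (hj : j < n) :
    HasStraightPath H f (2 * h) (P i) (P j) := by
  induction hr with
  | refl => exact .refl _ _ _ _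
  | @step h i k j hik hkj ih =>
    have hle := hkj.le hR
    have hle' : f (P k) ≤ f (P j) := by
      rcases hle.eq_or_lt with rfl | hlt
      · exact le_rfl
      · exact (hP _ _ hlt hj).le
    obtain ⟨w, a1, a2, l1, l2⟩ := hH i k hik (by omega)
    exact .cons a1 l1 (l2.trans hle') (.cons a2 l2 hle' (ih hj))

theorem Finset.exists_strictMono_enum {n : ℕ} (L : Finset ℝ) (hL : L.card = n) :
    ∃ P : ℕ → ℝ, (∀ i, i < n → P i ∈ L) ∧ (∀ i j, i < j → j < n → P i < P j) ∧
      ∀ a ∈ L, ∃ i, i < n ∧ P i = a := by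
  refine ⟨fun i => if h : i < n then L.orderEmbOfFin hL ⟨i, h⟩ else 0, ?_, ?_, ?_⟩
  · intro i hi
    simp only [dif_pos hi]
    exact Finset.orderEmbOfFin_mem _ _ _
  · intro i j hij hj
    simp only [dif_pos hj, dif_pos (hij.trans hj)]
    exact (L.orderEmbOfFin hL).strictMono hij
  · intro a ha
    have : a ∈ Set.range (L.orderEmbOfFin hL) := by
      rw [Finset.range_orderEmbOfFin]; exact ha
    obtain ⟨i, rfl⟩ := this
    exact ⟨i, i.2, by simp⟩

theorem Finset.exists_injOn_of_le_ncard {S : Finset ℝ} {A : Set ℝ} {s : ℕ}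
    (hs : s ≤ ((S : Set ℝ) ∩ A).ncard) :
    ∃ T : ℕ → ℝ, (∀ l, l < s → T l ∈ S ∧ T l ∈ A) ∧ Set.InjOn T (Set.Iio s) := by
  have hfin : ((S : Set ℝ) ∩ A).Finite := S.finite_toSet.inter_of_left A
  obtain ⟨P, h1, h2, -⟩ := hfin.toFinset.exists_strictMono_enum rfl
  rw [Set.ncard_eq_toFinset_card _ hfin] at hs
  refine ⟨P, fun l hl => ?_, ?_⟩
  · simpa using h1 l (by omega)
  · intro i hi j hj hij
    simp only [Set.mem_Iio] at hi hj
    by_contra hne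
    rcases Nat.lt_or_gt_of_ne hne with h | h
    · exact (h2 _ _ h (by omega)).ne hij
    · exact (h2 _ _ h (by omega)).ne' hij

/-- A spanner of the indices of `L` with bounded load per gap is realised by a Steiner spanner
with edges directed from points of `L` to Steiner points. -/
theorem HasLoadSpanner.exists_orientation {n k s : ℕ} {L S : Finset ℝ} {P : ℕ → ℝ}
    (H : HasLoadSpanner k n (12 * s)) (hs0 : 0 < s)
    (hPL : ∀ i, i < n → P i ∈ L) (hP : ∀ i j, i < j → j < n → P i < P j)
    (hLP : ∀ a ∈ L, ∃ i, i < n ∧ P i = a)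
    (hS : ∀ a ∈ L, ∀ b ∈ L, a < b → (∀ x ∈ L, ¬(a < x ∧ x < b)) →
      s ≤ ((S : Set ℝ) ∩ Set.Ioo a b).ncard) :
    ∃ D : {x : ℝ // x ∈ L ∨ x ∈ S} → {x : ℝ // x ∈ L ∨ x ∈ S} → Prop,
      (∀ u v, ¬(D u v ∧ D v u)) ∧ (∀ w, {u | D u w}.ncard ≤ 24) ∧
      ∀ i j (hi : i < n) (hj : j < n), i ≤ j →
        HasStraightPath (SimpleGraph.fromRel D) Subtype.val (2 * k)
          ⟨P i, .inl (hPL i hi)⟩ ⟨P j, .inl (hPL j hj)⟩ := by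
  obtain ⟨E, hE⟩ := H
  have hP' : ∀ i j, i ≤ j → j < n → P i ≤ P j := by
    intro i j hij hj
    rcases hij.eq_or_lt with rfl | h
    · exact le_rfl
    · exact (hP _ _ h hj).le
  have gap : ∀ g, g + 1 < n → ∀ x, P g < x → x < P (g + 1) → x ∉ L := by
    intro g hg x h1 h2 hx
    obtain ⟨i, hi, rfl⟩ := hLP x hx
    rcases Nat.lt_or_ge g i with h | h
    · exact (hP' (g + 1) i h hi).not_gt h2
    · exact (hP' i g h (by omega)).not_gt h1
  have hT : ∀ g, ∃ T : ℕ → ℝ, g + 1 < n → (∀ l, l < s → T l ∈ S ∧ T l ∈ Set.Ioo (P g) (P (g + 1)))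
      ∧ Set.InjOn T (Set.Iio s) := by
    intro g
    by_cases hg : g + 1 < n
    · obtain ⟨T, hT⟩ := Finset.exists_injOn_of_le_ncard
        (hS (P g) (hPL _ (by omega)) (P (g + 1)) (hPL _ hg) (hP _ _ (by omega) hg)
          fun x hx h => gap g hg x h.1 h.2 hx)
      exact ⟨T, fun _ => hT⟩
    · exact ⟨fun _ => 0, fun h => absurd h hg⟩
  choose T hT using hT
  have hmod : ∀ l, l % s < s := fun l => Nat.mod_lt _ hs0
  let D : {x : ℝ // x ∈ L ∨ x ∈ S} → {x : ℝ // x ∈ L ∨ x ∈ S} → Prop := fun u w =>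
    ∃ g l i j, l < 12 * s ∧ E g l = (i, j) ∧ i ≤ g ∧ g < j ∧ j < n ∧ w.1 = T g (l % s) ∧
      (u.1 = P i ∨ u.1 = P j)
  have hD : ∀ u w, D u w → u.1 ∈ L ∧ w.1 ∉ L := by
    rintro u w ⟨g, l, i, j, hl, he, h1, h2, hj, hw, hu⟩
    obtain ⟨-, hlo, hhi⟩ := (hT g (by omega)).1 _ (hmod l)
    refine ⟨?_, ?_⟩
    · rcases hu with hu | hu <;> rw [hu]
      · exact hPL _ (by omega)
      · exact hPL _ hj
    · rw [hw]
      exact gap g (by omega) _ hlo hhi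
  refine ⟨D, fun u v h => (hD _ _ h.1).2 (hD _ _ h.2).1, fun w => ?_, ?_⟩
  · rcases Set.eq_empty_or_nonempty {u | D u w} with he | ⟨u₀, g₀, l₀, i₀, j₀, -, -, a1, a2, a3, hw₀, -⟩
    · rw [he]; simp
    rw [← Set.ncard_image_of_injective _ Subtype.val_injective]
    let F : Finset ℝ := (Finset.range 12).image (fun c => P (E g₀ (s * c + l₀ % s)).1) ∪
      (Finset.range 12).image (fun c => P (E g₀ (s * c + l₀ % s)).2)
    have hF : F.card ≤ 24 := by
      refine (Finset.card_union_le _ _).trans ?_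
      have h1 := Finset.card_image_le (s := Finset.range 12)
        (f := fun c => P (E g₀ (s * c + l₀ % s)).1)
      have h2 := Finset.card_image_le (s := Finset.range 12)
        (f := fun c => P (E g₀ (s * c + l₀ % s)).2)
      rw [Finset.card_range] at h1 h2
      omega
    refine le_trans ?_ hF
    rw [← Set.ncard_coe_finset]
    refine Set.ncard_le_ncard ?_ (Finset.finite_toSet _)
    rintro _ ⟨u, ⟨g, l, i, j, hl, he, h1, h2, hj, hw, hu⟩, rfl⟩
    obtain ⟨-, hlo, hhi⟩ := (hT g (by omega)).1 _ (hmod l)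
    obtain ⟨-, hlo₀, hhi₀⟩ := (hT g₀ (by omega)).1 _ (hmod l₀)
    rw [← hw] at hlo hhi
    rw [← hw₀] at hlo₀ hhi₀
    have hg : g = g₀ := by
      rcases lt_trichotomy g g₀ with h | h | h
      · have := hP' (g + 1) g₀ h (by omega)
        linarith
      · exact h
      · have := hP' (g₀ + 1) g h (by omega)
        linarith
    subst hg
    have hll : l % s = l₀ % s := (hT g (by omega)).2 (hmod l) (hmod l₀) (hw ▸ hw₀)
    have hdiv : l / s < 12 := (Nat.div_lt_iff_lt_mul hs0).2 hl
    have hl' : s * (l / s) + l₀ % s = l := by rw [← hll, Nat.div_add_mod]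
    simp only [F, Finset.coe_union, Finset.coe_image, Finset.coe_range, Set.mem_union,
      Set.mem_image, Set.mem_Iio]
    rcases hu with hu | hu
    · exact .inl ⟨l / s, hdiv, by rw [hl', he, hu]⟩
    · exact .inr ⟨l / s, hdiv, by rw [hl', he, hu]⟩
  · intro i j hi hj hij
    let V : ℕ → {x : ℝ // x ∈ L ∨ x ∈ S} := fun i =>
      if h : i < n then ⟨P i, .inl (hPL i h)⟩ else ⟨P j, .inl (hPL j hj)⟩
    have hV : ∀ i (h : i < n), V i = ⟨P i, .inl (hPL i h)⟩ := fun i h => dif_pos h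
    rw [← hV i hi, ← hV j hj]
    refine (hE i j hij hj).hasStraightPath SlotLink.lt ?_ ?_ hj
    · intro a b hab hb
      rw [hV b hb, hV a (by omega)]
      exact hP a b hab hb
    · rintro a b ⟨g, l, hl, he, h1, h2⟩ hb
      obtain ⟨hmem, hlo, hhi⟩ := (hT g (by omega)).1 _ (hmod l)
      rw [hV b hb, hV a (by omega)]
      have d1 : D ⟨P a, .inl (hPL a (by omega))⟩ ⟨T g (l % s), .inr hmem⟩ :=
        ⟨g, l, a, b, hl, he, h1, h2, hb, rfl, .inl rfl⟩
      have d2 : D ⟨P b, .inl (hPL b hb)⟩ ⟨T g (l % s), .inr hmem⟩ :=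
        ⟨g, l, a, b, hl, he, h1, h2, hb, rfl, .inr rfl⟩
      have hne : ∀ {u w}, D u w → u ≠ w := by
        rintro u _ hd rfl
        exact (hD _ _ hd).2 (hD _ _ hd).1
      exact ⟨⟨T g (l % s), .inr hmem⟩, (SimpleGraph.fromRel_adj _ _ _).2 ⟨hne d1, .inl d1⟩,
        (SimpleGraph.fromRel_adj _ _ _).2 ⟨(hne d2).symm, .inr d2⟩,
        (hP' a g h1 (by omega)).trans hlo.le, hhi.le.trans (hP' (g + 1) b h2 hb)⟩

/-- There is an absolute constant `c` such that for all `n ≥ 2` and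
`k ≥ 2`, any set `L` of `n` points on the line with a set `S` of Steiner points having
`α_k(n)` points of `S` between every two consecutive points of `L` admits a Steiner
1-spanner with hop-diameter `2k` whose edges can be oriented with maximum in-degree at
most `c`. -/
theorem stmt11 :
    ∃ c : ℕ,
      ∀ n : ℕ, 2 ≤ n → ∀ k : ℕ, 2 ≤ k → ∀ L S : Finset ℝ, L.card = n →
        (∀ a ∈ L, ∀ b ∈ L, a < b → (∀ x ∈ L, ¬(a < x ∧ x < b)) →
          invAck k n ≤ ((S : Set ℝ) ∩ Set.Ioo a b).ncard) →
        ∃ (H : SimpleGraph {x : ℝ // x ∈ L ∨ x ∈ S})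
          (D : {x : ℝ // x ∈ L ∨ x ∈ S} → {x : ℝ // x ∈ L ∨ x ∈ S} → Prop),
          (∀ u v, D u v → H.Adj u v) ∧
          (∀ u v, H.Adj u v → D u v ∨ D v u) ∧
          (∀ u v, ¬(D u v ∧ D v u)) ∧
          (∀ w, {u | D u w}.ncard ≤ c) ∧
          (∀ a ∈ L, ∀ b ∈ L,
            ∃ (m : ℕ) (x : Fin (m + 1) → {x : ℝ // x ∈ L ∨ x ∈ S}),
              m ≤ 2 * k ∧ (x 0).1 = a ∧ (x (Fin.last m)).1 = b ∧
              (∀ i : Fin m, H.Adj (x i.castSucc) (x i.succ)) ∧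
              (∑ i : Fin m, |(x i.castSucc).1 - (x i.succ).1|) = |a - b|) := by
  refine ⟨24, fun n hn k hk L S hL hS => ?_⟩
  obtain ⟨P, hPL, hP, hLP⟩ := L.exists_strictMono_enum hL
  suffices h : ∃ D : {x : ℝ // x ∈ L ∨ x ∈ S} → {x : ℝ // x ∈ L ∨ x ∈ S} → Prop,
      (∀ u v, ¬(D u v ∧ D v u)) ∧ (∀ w, {u | D u w}.ncard ≤ 24) ∧
      ∀ i j (hi : i < n) (hj : j < n), i ≤ j →
        HasStraightPath (SimpleGraph.fromRel D) Subtype.val (2 * k)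
          ⟨P i, .inl (hPL i hi)⟩ ⟨P j, .inl (hPL j hj)⟩ by
    obtain ⟨D, hasymm, hdeg, hpath⟩ := h
    refine ⟨SimpleGraph.fromRel D, D, ?_, ?_, hasymm, hdeg, ?_⟩
    · intro u v huv
      rw [SimpleGraph.fromRel_adj]
      refine ⟨?_, .inl huv⟩
      rintro rfl
      exact hasymm u u ⟨huv, huv⟩
    · intro u v huv
      exact ((SimpleGraph.fromRel_adj _ _ _).1 huv).2
    · intro a ha b hb
      have key : HasStraightPath (SimpleGraph.fromRel D) Subtype.val (2 * k)
          ⟨a, .inl ha⟩ ⟨b, .inl hb⟩ := by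
        obtain ⟨i, hi, rfl⟩ := hLP a ha
        obtain ⟨j, hj, rfl⟩ := hLP b hb
        rcases le_total i j with h | h
        · exact hpath i j hi hj h
        · exact (hpath j i hj hi h).symm
      obtain ⟨m, x, hm, x0, xl, hadj, hsum⟩ := key
      exact ⟨m, x, hm, by rw [x0], by rw [xl], hadj, hsum⟩
  rcases hn.eq_or_lt with rfl | hn
  · have h01 : P 0 < P 1 := hP 0 1 (by omega) (by omega)
    refine ⟨fun u w => u.1 = P 0 ∧ w.1 = P 1, ?_, fun w => ?_, ?_⟩
    · rintro u v ⟨⟨h1, -⟩, -, h2⟩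
      exact h01.ne (h1.symm.trans h2)
    · refine (Set.ncard_le_ncard (t := {⟨P 0, .inl (hPL 0 (by omega))⟩}) ?_
        (Set.finite_singleton _)).trans (by rw [Set.ncard_singleton]; omega)
      exact fun u hu => Subtype.ext hu.1
    · intro i j hi hj hij
      rcases hij.eq_or_lt with rfl | hij
      · exact .refl _ _ _ _
      obtain ⟨rfl, rfl⟩ : i = 0 ∧ j = 1 := by omega
      obtain ⟨m, hm⟩ : ∃ m, 2 * k = m + 1 := ⟨2 * k - 1, by omega⟩
      rw [hm]
      refine .cons ((SimpleGraph.fromRel_adj _ _ _).2 ⟨?_, .inl ⟨rfl, rfl⟩⟩) h01.le le_rfl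
        (.refl _ _ _ _)
      exact fun h => h01.ne (congrArg Subtype.val h)
  · obtain ⟨hs, H⟩ := hasLoadSpanner_invAck hn hk
    exact H.exists_orientation hs hPL hP hLP hS
end

section
/- For every real x ≥ 1 and every integer k ≥ 4, it holds that x^{√((k−2)/k)} ≤ x − (x·ln x)/k + (x·(ln x)²)/k². -/
theorem Real.exp_neg_le_one_sub_add_sq {t : ℝ} (ht : 0 ≤ t) :
    Real.exp (-t) ≤ 1 - t + t ^ 2 := by
  have h := Real.quadratic_le_exp_of_nonneg ht
  rw [Real.exp_neg, inv_le_iff_one_le_mul₀ (Real.exp_pos t)]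
  have hq : 0 ≤ 1 - t + t ^ 2 := by nlinarith [sq_nonneg (t - 1)]
  calc (1 : ℝ) ≤ (1 - t + t ^ 2) * (1 + t + t ^ 2 / 2) := by
        nlinarith [pow_nonneg ht 2, pow_nonneg ht 3, pow_nonneg ht 4]
    _ ≤ (1 - t + t ^ 2) * Real.exp t := by gcongr

theorem Real.sqrt_sub_two_div_le {k : ℝ} (hk : 1 ≤ k) :
    Real.sqrt ((k - 2) / k) ≤ 1 - 1 / k := by
  have hk0 : 0 < k := by linarith
  refine Real.sqrt_le_iff.mpr ⟨sub_nonneg.mpr ((div_le_one hk0).mpr hk), ?_⟩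
  have h : (1 - 1 / k) ^ 2 = (k - 2) / k + (1 / k) ^ 2 := by
    field_simp
    ring
  rw [h]
  exact le_add_of_nonneg_right (sq_nonneg _)

/-- For every real `x ≥ 1` and every integer `k ≥ 4`,
`x^{√((k−2)/k)} ≤ x − (x·ln x)/k + (x·(ln x)²)/k²`. -/
theorem stmt18 (x : ℝ) (hx : 1 ≤ x) (k : ℕ) (hk : 4 ≤ k) :
    x ^ Real.sqrt (((k : ℝ) - 2) / (k : ℝ)) ≤
      x - x * Real.log x / (k : ℝ) + x * Real.log x ^ 2 / (k : ℝ) ^ 2 := by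
  have hx0 : 0 < x := by linarith
  have hk1 : (1 : ℝ) ≤ k := by exact_mod_cast (by omega : 1 ≤ k)
  have ht : 0 ≤ Real.log x / k := div_nonneg (Real.log_nonneg hx) (by linarith)
  calc x ^ Real.sqrt (((k : ℝ) - 2) / (k : ℝ))
      ≤ x ^ (1 - 1 / (k : ℝ)) :=
        Real.rpow_le_rpow_of_exponent_le hx (Real.sqrt_sub_two_div_le hk1)
    _ = x * Real.exp (-(Real.log x / k)) := by
        rw [sub_eq_add_neg, Real.rpow_add hx0, Real.rpow_one, Real.rpow_def_of_pos hx0]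
        congr 2
        ring
    _ ≤ x * (1 - Real.log x / k + (Real.log x / k) ^ 2) := by
        gcongr
        exact Real.exp_neg_le_one_sub_add_sq ht
    _ = x - x * Real.log x / (k : ℝ) + x * Real.log x ^ 2 / (k : ℝ) ^ 2 := by ring
end
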